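/- arXiv:2310.16476 — 3 statements merged into one kernel-verified Lean document; each statement's English description precedes it below -/
import Mathlib

section
/- There exists ε* > 0, depending only on σ and θ, such that for all ε ∈ (0, ε*), setting M_ε := (log ε^{−1})^{1+4/θ}: Leb(Θ_ε ∩ 𝔹_{M_ε}(0,ε)) ≥ (1 − ε^{1/6}) · Leb(𝔹_{M_ε}(0,ε)), where Leb denotes Lebesgue measure on the finite-dimensional real vector space 𝒢_{M_ε} and 𝔹_{M_ε}(0,ε) := {z ∈ 𝒢_{M_ε} : ‖z‖_σ < ε}. -/
noncomputable section

attribute [local instance] Classical.propDecidable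

open scoped BigOperators

/-- The Gevrey weight `e^(σ |a|^θ)`. -/
def wt (σ θ : ℝ) (a : ℤ) : ℝ := Real.exp (σ * |(a : ℝ)| ^ θ)

/-- The Gevrey norm `‖z‖_σ = 2 ∑_a e^(σ|a|^θ) |z_a|`. -/
def gNorm (σ θ : ℝ) (z : ℤ → ℂ) : ℝ := 2 * ∑' a : ℤ, wt σ θ a * ‖z a‖

/-- Membership in the Gevrey space `𝒢`. -/
def inG (σ θ : ℝ) (z : ℤ → ℂ) : Prop := Summable fun a : ℤ => wt σ θ a * ‖z a‖

/-- `z_{(δ,a)}`: `z_a` if `δ = 1`, the conjugate if `δ = -1`. -/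
def idxVal (z : ℤ → ℂ) (p : ℤ × ℤ) : ℂ :=
  if p.1 = 1 then z p.2 else (starRingEnd ℂ) (z p.2)

/-- The monomial `z_𝐣`. -/
def zProd {n : ℕ} (z : ℤ → ℂ) (j : Fin n → ℤ × ℤ) : ℂ := ∏ α, idxVal z (j α)

/-- The signs of the multi-index belong to `𝕌₂ = {-1, 1}`. -/
def isU2 {n : ℕ} (j : Fin n → ℤ × ℤ) : Prop := ∀ α, (j α).1 = 1 ∨ (j α).1 = -1

/-- Zero momentum multi-indices (the set `M_m`, with `n = 2m`). -/
def inM {n : ℕ} (j : Fin n → ℤ × ℤ) : Prop :=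
  isU2 j ∧ ∑ α, (j α).1 = 0 ∧ ∑ α, (j α).1 * (j α).2 = 0

/-- Resonant multi-indices (the set `R_m`, with `n = 2m`). -/
def inR {n : ℕ} (j : Fin n → ℤ × ℤ) : Prop :=
  inM j ∧ ∑ α, (j α).1 * (j α).2 ^ 2 = 0

/-- Integrable multi-indices: the entries can be paired as `{(δ,a), (-δ,a)}`. -/
def integ {n : ℕ} (j : Fin n → ℤ × ℤ) : Prop :=
  ∃ φ : Equiv.Perm (Fin n), ∀ α, j (φ α) = (-(j α).1, (j α).2)

/-- `⟨a⟩ = max(1, |a|)`. -/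
def brk (a : ℤ) : ℕ := max 1 a.natAbs

/-- The modulated frequencies `ω_𝐣^M(z)` with finite cut-off `M`. -/
def omegaM (M : ℝ) {n : ℕ} (j : Fin n → ℤ × ℤ) (z : ℤ → ℂ) : ℝ :=
  ∑ β, ((j β).1 : ℝ) *
    ∑' a : ℤ, if a ≠ (j β).2 ∧ |(a : ℝ)| ≤ M then
      ‖z a‖ ^ 2 / ((a : ℝ) - ((j β).2 : ℝ)) ^ 2 else 0

/-- The modulated frequencies `ω_𝐣^∞(z)`. -/
def omegaInf {n : ℕ} (j : Fin n → ℤ × ℤ) (z : ℤ → ℂ) : ℝ :=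
  ∑ β, ((j β).1 : ℝ) *
    ∑' a : ℤ, if a ≠ (j β).2 then
      ‖z a‖ ^ 2 / ((a : ℝ) - ((j β).2 : ℝ)) ^ 2 else 0

/-- The projection `Π_M` on the modes `|a| ≤ M`. -/
def PiM (M : ℝ) (z : ℤ → ℂ) : ℤ → ℂ := fun a => if |(a : ℝ)| ≤ M then z a else 0

/-- The optimal order `r_ε`. -/
def rEps (σ θ ε : ℝ) : ℕ :=
  Nat.floor ((min 1 σ * θ * (1 - θ) / 500) * Real.log ε⁻¹ / Real.log (Real.log ε⁻¹))

/-- The truncation parameter `N_ε`. -/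
def NEps (θ ε : ℝ) : ℝ := Real.log ε⁻¹ ^ ((2 : ℝ) / θ)

/-- The truncation parameter `L_ε = 6 r_ε N_ε²`. -/
def LEps (σ θ ε : ℝ) : ℝ := 6 * (rEps σ θ ε : ℝ) * NEps θ ε ^ 2

/-- `δ_ε = ε^(5/2)`. -/
def dEps (ε : ℝ) : ℝ := ε ^ ((5 : ℝ) / 2)

/-- Membership in the non-resonant set `𝔙_δ^{r,M}`: for every non-integrable resonant
multi-index `𝐣` with at most `r` entries and `μ₁(𝐣) ≤ M`, one has `|ω_𝐣^M(z)| > δ`. -/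
def inV (δ r M : ℝ) (z : ℤ → ℂ) : Prop :=
  ∀ m : ℕ, 1 ≤ m → ∀ j : Fin (2 * m) → ℤ × ℤ,
    inR j → ¬ integ j → (2 * m : ℝ) ≤ r → (∀ β, (brk ((j β).2) : ℝ) ≤ M) →
    δ < |omegaM M j z|

/-- The set `Θ_ε` of good initial data. -/
def inTheta (σ θ ε : ℝ) (z : ℤ → ℂ) : Prop :=
  inV (10 * dEps ε) (6 * (rEps σ θ ε : ℝ)) (LEps σ θ ε) (PiM (LEps σ θ ε) z)


open MeasureTheory

/-- The integer cut-off `⌊M⌋` corresponding to a real truncation parameter `M`: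
for an integer `a`, `|a| ≤ M ↔ a ∈ [-⌊M⌋, ⌊M⌋]`. -/
def Kfl (M : ℝ) : ℤ := Int.floor M

/-- The identification of `𝒢_M = ℂ^{{a ∈ ℤ : |a| ≤ M}}` with a subspace of `ℂ^ℤ`. -/
def embed (M : ℝ) (v : ↥(Finset.Icc (-(Kfl M)) (Kfl M)) → ℂ) : ℤ → ℂ :=
  fun a => if h : a ∈ Finset.Icc (-(Kfl M)) (Kfl M) then v ⟨a, h⟩ else 0

theorem volume_norm_sq_near_le {c : ℝ} (hc : c ≠ 0) (t : ℝ) {D : ℝ} (hD : 0 ≤ D) :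
    volume {x : ℂ | |c * ‖x‖ ^ 2 + t| ≤ D} ≤ ENNReal.ofReal (2 * Real.pi * D / |c|) := by
  have hc' : 0 < |c| := abs_pos.mpr hc
  set l : ℝ := max 0 (-t / c - D / |c|) with hl
  set u : ℝ := max 0 (-t / c + D / |c|) with hu
  have hDc : 0 ≤ D / |c| := by positivity
  have hlu : l ≤ u := max_le_max le_rfl (by linarith)
  have hl0 : 0 ≤ l := le_max_left _ _
  have hu0 : 0 ≤ u := le_max_left _ _
  have hdiff : u - l ≤ 2 * (D / |c|) := by
    rw [hl, hu]
    rcases max_cases (0 : ℝ) (-t / c - D / |c|) with h | h <;>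
      rcases max_cases (0 : ℝ) (-t / c + D / |c|) with h' | h' <;> linarith
  have hsub : {x : ℂ | |c * ‖x‖ ^ 2 + t| ≤ D} ⊆
      Metric.closedBall 0 (√u) \ Metric.ball 0 (√l) := by
    intro x hx
    have hx' : |‖x‖ ^ 2 - -t / c| ≤ D / |c| := by
      rw [le_div_iff₀ hc', ← abs_mul]
      have : (‖x‖ ^ 2 - -t / c) * c = c * ‖x‖ ^ 2 + t := by
        rw [sub_mul, div_mul_cancel₀ _ hc]
        ring
      rw [this]
      exact hx
    rw [abs_le] at hx'
    simp only [Set.mem_sdiff, Metric.mem_closedBall, dist_zero_right, Metric.mem_ball, not_lt]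
    constructor
    · exact Real.le_sqrt_of_sq_le (le_max_of_le_right (by linarith))
    · rw [Real.sqrt_le_left (norm_nonneg x)]
      exact max_le (by positivity) (by linarith)
  refine (measure_mono hsub).trans ?_
  have hbb : Metric.ball (0 : ℂ) (√l) ⊆ Metric.closedBall 0 (√u) :=
    Metric.ball_subset_closedBall.trans (Metric.closedBall_subset_closedBall (Real.sqrt_le_sqrt hlu))
  rw [measure_sdiff hbb measurableSet_ball.nullMeasurableSet measure_ball_lt_top.ne,
    Complex.volume_closedBall, Complex.volume_ball, ← ENNReal.ofReal_pow (Real.sqrt_nonneg _),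
    ← ENNReal.ofReal_pow (Real.sqrt_nonneg _), Real.sq_sqrt hl0, Real.sq_sqrt hu0]
  have hpi : (NNReal.pi : ENNReal) = ENNReal.ofReal Real.pi := by
    rw [← NNReal.coe_real_pi, ENNReal.ofReal_coe_nnreal]
  rw [hpi, ← ENNReal.ofReal_mul hu0, ← ENNReal.ofReal_mul hl0,
    ← ENNReal.ofReal_sub _ (by positivity)]
  apply ENNReal.ofReal_le_ofReal
  calc u * Real.pi - l * Real.pi = Real.pi * (u - l) := by ring
    _ ≤ Real.pi * (2 * (D / |c|)) := by gcongr
    _ = _ := by ring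

theorem exists_measurePreserving_coord_prod {ι : Type*} [Fintype ι] (i : ι) :
    ∃ g : (ι → ℂ) ≃ᵐ ℂ × ({k // ¬ k = i} → ℂ), MeasurePreserving g ∧
      ∀ v, g v = (v i, fun k : {k // ¬ k = i} => v k) := by
  refine ⟨(MeasurableEquiv.piEquivPiSubtypeProd (fun _ : ι => ℂ) (· = i)).trans
    (MeasurableEquiv.prodCongr (MeasurableEquiv.funUnique {k // k = i} ℂ)
      (MeasurableEquiv.refl _)), ?_, fun v => rfl⟩
  have h := volume_preserving_piEquivPiSubtypeProd (fun _ : ι => ℂ) (· = i)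
  rw [Measure.volume_eq_prod] at h ⊢
  have h' : MeasurePreserving (MeasurableEquiv.funUnique {k // k = i} ℂ)
      (@volume _ (@MeasureSpace.pi _ (Subtype.fintype fun k => k = i) _ _)) volume := by
    convert volume_preserving_funUnique {k // k = i} ℂ
  exact (h'.prod (MeasurePreserving.id _)).comp h

section
variable {ι : Type*} [Fintype ι]

theorem sum_eq_add_sum_ne (i : ι) (f : ι → ℝ) :
    ∑ k, f k = f i + ∑ k : {k // ¬ k = i}, f k :=
  Fintype.sum_eq_add_sum_subtype_ne f i

theorem volume_quadratic_le_slice {w c : ι → ℝ} (hw : ∀ k, 0 < w k) {i : ι} (hc : c i ≠ 0)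
    (R : ℝ) {D : ℝ} (hD : 0 ≤ D) :
    volume {v : ι → ℂ | ∑ k, w k * ‖v k‖ < R ∧ |∑ k, c k * ‖v k‖ ^ 2| ≤ D} ≤
      ENNReal.ofReal (2 * Real.pi * D / |c i|) *
        volume {y : {k // ¬ k = i} → ℂ | ∑ k : {k // ¬ k = i}, w k * ‖y k‖ < R} := by
  obtain ⟨g, hg, hgv⟩ := exists_measurePreserving_coord_prod i
  set A : Set ({k // ¬ k = i} → ℂ) := {y | ∑ k : {k // ¬ k = i}, w k * ‖y k‖ < R}
  set U : Set (ℂ × ({k // ¬ k = i} → ℂ)) :=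
    {p | p.2 ∈ A ∧ |c i * ‖p.1‖ ^ 2 + ∑ k : {k // ¬ k = i}, c k * ‖p.2 k‖ ^ 2| ≤ D}
  have hA : MeasurableSet A := by
    simp only [A]
    exact measurableSet_lt (by fun_prop) measurable_const
  have hU : MeasurableSet U := by
    refine (measurable_snd hA).inter ?_
    exact measurableSet_le (f := fun p : ℂ × ({k // ¬ k = i} → ℂ) =>
      |c i * ‖p.1‖ ^ 2 + ∑ k : {k // ¬ k = i}, c k * ‖p.2 k‖ ^ 2|) (by fun_prop) measurable_const
  have hsub : {v : ι → ℂ | ∑ k, w k * ‖v k‖ < R ∧ |∑ k, c k * ‖v k‖ ^ 2| ≤ D} ⊆ g ⁻¹' U := by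
    rintro v ⟨h1, h2⟩
    rw [sum_eq_add_sum_ne i] at h1 h2
    simp only [Set.mem_preimage, hgv, U, A, Set.mem_ofPred_eq]
    have : 0 ≤ w i * ‖v i‖ := mul_nonneg (hw i).le (norm_nonneg _)
    exact ⟨by linarith, h2⟩
  refine (measure_mono hsub).trans ?_
  rw [hg.measure_preimage_equiv, Measure.volume_eq_prod, Measure.prod_apply_symm hU]
  calc ∫⁻ y, volume ((fun x => (x, y)) ⁻¹' U)
      ≤ ∫⁻ y, A.indicator (fun _ => ENNReal.ofReal (2 * Real.pi * D / |c i|)) y := by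
        refine lintegral_mono fun y => ?_
        by_cases hy : y ∈ A
        · rw [Set.indicator_of_mem hy]
          refine (measure_mono ?_).trans
            (volume_norm_sq_near_le hc (∑ k : {k // ¬ k = i}, c k * ‖y k‖ ^ 2) hD)
          exact fun x hx => hx.2
        · have : (fun x : ℂ => (x, y)) ⁻¹' U = ∅ := by
            ext x; simp [U, hy]
          simp [this]
    _ = _ := by rw [lintegral_indicator_const hA]

open scoped Pointwise in
theorem slice_le_volume_weighted_ball {w : ι → ℝ} (hw : ∀ k, 0 < w k) (i : ι) {R : ℝ}
    (hR : 0 < R) :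
    ENNReal.ofReal (Real.pi * R ^ 2 / (32 * (Fintype.card ι : ℝ) ^ 2 * w i ^ 2)) *
        volume {y : {k // ¬ k = i} → ℂ | ∑ k : {k // ¬ k = i}, w k * ‖y k‖ < R} ≤
      volume {v : ι → ℂ | ∑ k, w k * ‖v k‖ < R} := by
  obtain ⟨g, hg, hgv⟩ := exists_measurePreserving_coord_prod i
  set A : Set ({k // ¬ k = i} → ℂ) := {y | ∑ k : {k // ¬ k = i}, w k * ‖y k‖ < R}
  have hn : 1 ≤ Fintype.card ι := Fintype.card_pos_iff.mpr ⟨i⟩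
  set n : ℕ := Fintype.card ι
  have hn' : (1 : ℝ) ≤ n := by exact_mod_cast hn
  have hwi := hw i
  set s : ℝ := 1 / (4 * n) with hs
  have hs0 : 0 < s := by positivity
  have hsn : s * n = 1 / 4 := by rw [hs]; field_simp
  have hs1 : s < 1 := by nlinarith
  have hsub : g ⁻¹' (Metric.ball 0 (s * R / w i) ×ˢ ((1 - s) • A)) ⊆
      {v : ι → ℂ | ∑ k, w k * ‖v k‖ < R} := by
    intro v hv
    rw [Set.mem_preimage, hgv, Set.mem_prod, Set.mem_smul_set] at hv
    obtain ⟨h1, y, hy, hyv⟩ := hv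
    rw [mem_ball_zero_iff, lt_div_iff₀ hwi] at h1
    rw [Set.mem_ofPred_eq, sum_eq_add_sum_ne i]
    have h2 : ∑ k : {k // ¬ k = i}, w k * ‖v k‖ =
        (1 - s) * ∑ k : {k // ¬ k = i}, w k * ‖y k‖ := by
      rw [Finset.mul_sum]
      refine Finset.sum_congr rfl fun k _ => ?_
      rw [show v k = (1 - s) • y k from (congrFun hyv k).symm, norm_smul,
        Real.norm_of_nonneg (by linarith)]
      ring
    have h3 : ∑ k : {k // ¬ k = i}, w k * ‖y k‖ < R := hy
    rw [h2]
    nlinarith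
  refine le_trans ?_ (measure_mono hsub)
  rw [hg.measure_preimage_equiv, Measure.volume_eq_prod, Measure.prod_prod,
    Measure.addHaar_smul, Complex.volume_ball, ← mul_assoc]
  gcongr
  have hpi : (NNReal.pi : ENNReal) = ENNReal.ofReal Real.pi := by
    rw [← NNReal.coe_real_pi, ENNReal.ofReal_coe_nnreal]
  have hdim : Module.finrank ℝ ({k // ¬ k = i} → ℂ) ≤ 2 * n := by
    rw [Module.finrank_pi_fintype]
    simp only [Complex.finrank_real_complex, Finset.sum_const, Finset.card_univ, smul_eq_mul]
    have := Fintype.card_subtype_le (fun k : ι => ¬ k = i)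
    omega
  have hpow : 1 / 2 ≤ (1 - s) ^ Module.finrank ℝ ({k // ¬ k = i} → ℂ) := by
    refine le_trans ?_ (pow_le_pow_of_le_one (by linarith) (by linarith) hdim)
    have := one_add_mul_le_pow (a := -s) (by linarith) (2 * n)
    rw [← sub_eq_add_neg] at this
    push_cast at this
    linarith
  rw [hpi, ← ENNReal.ofReal_pow (by positivity), ← ENNReal.ofReal_mul (by positivity),
    ← ENNReal.ofReal_mul (by positivity), abs_of_nonneg (by positivity)]
  apply ENNReal.ofReal_le_ofReal
  calc _ = (s * R / w i) ^ 2 * Real.pi * (1 / 2) := by rw [hs]; field_simp; norm_num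
    _ ≤ _ := by gcongr

theorem volume_quadratic_le_weighted_ball {w c : ι → ℝ} (hw : ∀ k, 0 < w k) {i : ι}
    (hc : c i ≠ 0) {R D : ℝ} (hR : 0 < R) (hD : 0 ≤ D) :
    volume {v : ι → ℂ | ∑ k, w k * ‖v k‖ < R ∧ |∑ k, c k * ‖v k‖ ^ 2| ≤ D} ≤
      ENNReal.ofReal (64 * (Fintype.card ι : ℝ) ^ 2 * w i ^ 2 * D / (|c i| * R ^ 2)) *
        volume {v : ι → ℂ | ∑ k, w k * ‖v k‖ < R} := by
  have hn : (0 : ℝ) < Fintype.card ι := by exact_mod_cast Fintype.card_pos_iff.mpr ⟨i⟩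
  have hwi := hw i
  have hci := abs_pos.mpr hc
  refine (volume_quadratic_le_slice hw hc R hD).trans ?_
  refine le_trans (le_of_eq ?_) (mul_le_mul_right (slice_le_volume_weighted_ball hw i hR) _)
  rw [← mul_assoc, ← ENNReal.ofReal_mul (by positivity)]
  congr 2
  field_simp
  ring

theorem volume_weighted_ball_lt_top {w : ι → ℝ} (hw : ∀ k, 1 ≤ w k) (R : ℝ) :
    volume {v : ι → ℂ | ∑ k, w k * ‖v k‖ < R} < ⊤ := by
  refine (measure_mono ?_).trans_lt (measure_closedBall_lt_top (x := (0 : ι → ℂ)) (r := |R|))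
  intro v hv
  rw [mem_closedBall_zero_iff, pi_norm_le_iff_of_nonneg (abs_nonneg R)]
  intro k
  have h1 : w k * ‖v k‖ ≤ ∑ k, w k * ‖v k‖ :=
    Finset.single_le_sum (f := fun k => w k * ‖v k‖)
      (fun k _ => mul_nonneg (by linarith [hw k]) (norm_nonneg _)) (Finset.mem_univ k)
  have h2 : ‖v k‖ ≤ w k * ‖v k‖ := le_mul_of_one_le_left (norm_nonneg _) (hw k)
  have := hv.out
  linarith [le_abs_self R]
end

theorem integ_of_fiber_sum_eq_zero {n : ℕ} {j : Fin n → ℤ × ℤ} (hU : isU2 j)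
    (h : ∀ b, ∑ β with (j β).2 = b, (j β).1 = 0) : integ j := by
  have hcount : ∀ b : ℤ, Fintype.card {β // j β = (1, b)} = Fintype.card {β // j β = (-1, b)} := by
    intro b
    rw [Fintype.card_subtype, Fintype.card_subtype]
    have h1 : ∑ β with (j β).2 = b, (j β).1 =
        ∑ β, ((if j β = (1, b) then 1 else 0) - (if j β = (-1, b) then 1 else 0) : ℤ) := by
      rw [Finset.sum_filter]
      refine Finset.sum_congr rfl fun β _ => ?_
      rcases hU β with hβ | hβ <;> by_cases hb : (j β).2 = b <;> simp [Prod.ext_iff, hβ, hb]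
    rw [h b, Finset.sum_sub_distrib, Finset.sum_boole, Finset.sum_boole] at h1
    have := sub_eq_zero.mp h1.symm
    exact_mod_cast this
  have hfib : ∀ p : ℤ × ℤ,
      Nonempty ({β // ((-(j β).1, (j β).2) : ℤ × ℤ) = p} ≃ {β // j β = p}) := by
    rintro ⟨s, b⟩
    rw [← Fintype.card_eq]
    have hneg : ∀ β, ((-(j β).1, (j β).2) : ℤ × ℤ) = (s, b) ↔ j β = (-s, b) := by
      intro β
      simp [Prod.ext_iff, neg_eq_iff_eq_neg]
    simp only [hneg]
    by_cases hs : s = 1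
    · subst hs; exact (hcount b).symm
    by_cases hs' : s = -1
    · subst hs'; simpa using hcount b
    · have e1 : ∀ β, ¬ j β = (s, b) := fun β hβ => by
        rcases hU β with h' | h' <;> simp_all
      have e2 : ∀ β, ¬ j β = (-s, b) := fun β hβ => by
        rcases hU β with h' | h' <;> rw [hβ] at h' <;> simp at h' <;> omega
      simp [e1, e2]
  exact ⟨Equiv.ofFiberEquiv fun p => (hfib p).some, fun α =>
    Equiv.ofFiberEquiv_map (fun p => (hfib p).some) α⟩

/-- The coefficient of `‖z a‖ ^ 2` in the modulated frequency `ω_𝐣`. -/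
def modCoeff {n : ℕ} (j : Fin n → ℤ × ℤ) (a : ℤ) : ℝ :=
  ∑ β, ((j β).1 : ℝ) * if a ≠ (j β).2 then 1 / ((a : ℝ) - ((j β).2 : ℝ)) ^ 2 else 0

open Polynomial in
theorem exists_nonroot_of_partial_fractions (T : Finset ℤ) (N : ℤ → ℤ) {b₀ : ℤ} (hb₀ : b₀ ∈ T)
    (hN : N b₀ ≠ 0) :
    ∃ a : ℤ, 0 ≤ a ∧ a ≤ 3 * T.card ∧ a ∉ T ∧
      ∑ b ∈ T, N b * ∏ b' ∈ T.erase b, (a - b') ^ 2 ≠ 0 := by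
  set P : ℤ[X] := ∑ b ∈ T, C (N b) * ∏ b' ∈ T.erase b, (X - C b') ^ 2 with hP
  have heval : ∀ a : ℤ, P.eval a = ∑ b ∈ T, N b * ∏ b' ∈ T.erase b, (a - b') ^ 2 := by
    intro a
    simp [hP, eval_finsetSum, eval_prod]
  have hP0 : P ≠ 0 := by
    intro h0
    have h1 := heval b₀
    rw [h0, eval_zero, Finset.sum_eq_single_of_mem b₀ hb₀] at h1
    · refine (mul_ne_zero hN (Finset.prod_ne_zero_iff.mpr fun b' hb' => ?_)) h1.symm
      exact pow_ne_zero _ (sub_ne_zero.mpr (Finset.ne_of_mem_erase hb').symm)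
    · intro b _ hb
      rw [Finset.prod_eq_zero (Finset.mem_erase.mpr ⟨hb.symm, hb₀⟩) (by simp), mul_zero]
  have hdeg : P.natDegree ≤ 2 * T.card := by
    refine natDegree_sum_le_of_forall_le _ _ fun b _ => ?_
    refine (natDegree_C_mul_le _ _).trans ((natDegree_prod_le _ _).trans ?_)
    calc ∑ b' ∈ T.erase b, ((X - C b') ^ 2 : ℤ[X]).natDegree ≤ ∑ b' ∈ T.erase b, 2 :=
          Finset.sum_le_sum fun b' _ => by rw [natDegree_pow, natDegree_X_sub_C]
      _ ≤ 2 * T.card := by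
          rw [Finset.sum_const, smul_eq_mul, mul_comm]
          exact Nat.mul_le_mul_left _ (Finset.card_le_card (Finset.erase_subset _ _))
  have hcard : (T ∪ P.roots.toFinset).card < (Finset.Icc (0 : ℤ) (3 * T.card)).card := by
    rw [Int.card_Icc]
    have h1 := Finset.card_union_le T P.roots.toFinset
    have h2 := P.roots.toFinset_card_le
    have h3 := P.card_roots'
    omega
  obtain ⟨a, ha, ha'⟩ := Finset.exists_mem_notMem_of_card_lt_card hcard
  rw [Finset.mem_Icc] at ha
  rw [Finset.mem_union, not_or, Multiset.mem_toFinset, mem_roots hP0, IsRoot.def, heval] at ha'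
  exact ⟨a, ha.1, ha.2, ha'.1, ha'.2⟩

theorem exists_modCoeff_lower_bound {n : ℕ} {j : Fin n → ℤ × ℤ} (hU : isU2 j) (hj : ¬ integ j)
    {L : ℝ} (hL : 1 ≤ 2 * L) (hnL : 3 * (n : ℝ) ≤ L) (hjL : ∀ β, |((j β).2 : ℝ)| ≤ L) :
    ∃ a : ℤ, 0 ≤ a ∧ a ≤ 3 * n ∧ 1 ≤ |modCoeff j a| * (2 * L) ^ (2 * n) := by
  set T : Finset ℤ := Finset.univ.image fun β => (j β).2 with hT
  set N : ℤ → ℤ := fun b => ∑ β with (j β).2 = b, (j β).1 with hN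
  have hTn : T.card ≤ n := by
    simpa using Finset.card_image_le (s := Finset.univ) (f := fun β => (j β).2)
  have hmem : ∀ β, (j β).2 ∈ T := fun β => Finset.mem_image_of_mem _ (Finset.mem_univ β)
  obtain ⟨b₀, hb₀⟩ : ∃ b, N b ≠ 0 := by
    by_contra! h
    exact hj (integ_of_fiber_sum_eq_zero hU h)
  have hb₀T : b₀ ∈ T := by
    obtain ⟨β, hβ, -⟩ := Finset.exists_ne_zero_of_sum_ne_zero hb₀
    rw [← (Finset.mem_filter.mp hβ).2]
    exact hmem β
  obtain ⟨a, ha0, ha3, haT, hne⟩ := exists_nonroot_of_partial_fractions T N hb₀T hb₀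
  have ha3n : a ≤ 3 * n := ha3.trans (by exact_mod_cast Nat.mul_le_mul_left 3 hTn)
  refine ⟨a, ha0, ha3n, ?_⟩
  have hsub : ∀ b ∈ T, (a : ℝ) - b ≠ 0 := fun b hb => by
    rw [sub_ne_zero]
    exact_mod_cast fun h : a = b => haT (h ▸ hb)
  have hcoef : modCoeff j a = ∑ b ∈ T, (N b : ℝ) * (1 / ((a : ℝ) - b) ^ 2) := by
    have : modCoeff j a = ∑ β, ((j β).1 : ℝ) * (1 / ((a : ℝ) - ((j β).2 : ℝ)) ^ 2) := by
      refine Finset.sum_congr rfl fun β _ => ?_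
      rw [if_pos fun h : a = (j β).2 => haT (h ▸ hmem β)]
    rw [this, ← Finset.sum_fiberwise_of_maps_to (t := T) (g := fun β => (j β).2)
      (fun β _ => hmem β)]
    refine Finset.sum_congr rfl fun b _ => ?_
    rw [hN, Int.cast_sum, Finset.sum_mul]
    refine Finset.sum_congr rfl fun β hβ => ?_
    rw [(Finset.mem_filter.mp hβ).2]
  have hprod : modCoeff j a * ∏ b ∈ T, ((a : ℝ) - b) ^ 2 =
      ((∑ b ∈ T, N b * ∏ b' ∈ T.erase b, (a - b') ^ 2 : ℤ) : ℝ) := by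
    rw [hcoef, Finset.sum_mul]
    push_cast
    refine Finset.sum_congr rfl fun b hb => ?_
    rw [← Finset.mul_prod_erase T _ hb]
    have := hsub b hb
    field_simp
  have hone : 1 ≤ |modCoeff j a| * ∏ b ∈ T, ((a : ℝ) - b) ^ 2 := by
    have h0 : 0 ≤ ∏ b ∈ T, ((a : ℝ) - b) ^ 2 := Finset.prod_nonneg fun b _ => sq_nonneg _
    rw [← abs_of_nonneg h0, ← abs_mul, hprod]
    exact_mod_cast Int.one_le_abs hne
  refine hone.trans (mul_le_mul_of_nonneg_left ?_ (abs_nonneg _))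
  have haL : |(a : ℝ)| ≤ L := by
    rw [abs_of_nonneg (by exact_mod_cast ha0)]
    exact le_trans (by exact_mod_cast ha3n) hnL
  calc ∏ b ∈ T, ((a : ℝ) - b) ^ 2 ≤ ∏ b ∈ T, (2 * L) ^ 2 := by
        refine Finset.prod_le_prod (fun b _ => sq_nonneg _) fun b hb => ?_
        obtain ⟨β, -, rfl⟩ := Finset.mem_image.mp hb
        rw [← sq_abs]
        have := abs_sub (a : ℝ) ((j β).2 : ℝ)
        gcongr
        linarith [hjL β]
    _ = (2 * L) ^ (2 * T.card) := by rw [Finset.prod_const, ← pow_mul]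
    _ ≤ (2 * L) ^ (2 * n) := pow_le_pow_right₀ hL (by omega)

theorem embed_apply_coe (M : ℝ) (v : ↥(Finset.Icc (-(Kfl M)) (Kfl M)) → ℂ)
    (i : ↥(Finset.Icc (-(Kfl M)) (Kfl M))) : embed M v i = v i := by
  simp only [embed, i.2, dif_pos]

theorem embed_apply_of_notMem (M : ℝ) (v : ↥(Finset.Icc (-(Kfl M)) (Kfl M)) → ℂ) {a : ℤ}
    (ha : a ∉ Finset.Icc (-(Kfl M)) (Kfl M)) : embed M v a = 0 := by
  simp only [embed, ha, dif_neg, not_false_eq_true]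

theorem gNorm_embed (σ θ M : ℝ) (v : ↥(Finset.Icc (-(Kfl M)) (Kfl M)) → ℂ) :
    gNorm σ θ (embed M v) =
      2 * ∑ i : ↥(Finset.Icc (-(Kfl M)) (Kfl M)), wt σ θ i * ‖v i‖ := by
  rw [gNorm, tsum_eq_sum (s := Finset.Icc (-(Kfl M)) (Kfl M))
    fun a ha => by rw [embed_apply_of_notMem M v ha, norm_zero, mul_zero],
    ← Finset.sum_coe_sort]
  simp only [embed_apply_coe]

theorem omegaM_PiM_embed (L M : ℝ) {n : ℕ} (j : Fin n → ℤ × ℤ)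
    (v : ↥(Finset.Icc (-(Kfl M)) (Kfl M)) → ℂ) :
    omegaM L j (PiM L (embed M v)) =
      ∑ i : ↥(Finset.Icc (-(Kfl M)) (Kfl M)),
        (if |((i : ℤ) : ℝ)| ≤ L then modCoeff j i else 0) * ‖v i‖ ^ 2 := by
  have htsum : ∀ b : ℤ, (∑' a : ℤ, if a ≠ b ∧ |(a : ℝ)| ≤ L then
      ‖PiM L (embed M v) a‖ ^ 2 / ((a : ℝ) - (b : ℝ)) ^ 2 else 0) =
      ∑ i : ↥(Finset.Icc (-(Kfl M)) (Kfl M)), (if |((i : ℤ) : ℝ)| ≤ L then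
        (if (i : ℤ) ≠ b then 1 / (((i : ℤ) : ℝ) - (b : ℝ)) ^ 2 else 0) else 0) * ‖v i‖ ^ 2 := by
    intro b
    rw [tsum_eq_sum (s := Finset.Icc (-(Kfl M)) (Kfl M)) fun a ha => by
      simp [PiM, embed_apply_of_notMem M v ha], ← Finset.sum_coe_sort]
    refine Finset.sum_congr rfl fun i _ => ?_
    by_cases h1 : |((i : ℤ) : ℝ)| ≤ L <;> by_cases h2 : (i : ℤ) = b <;>
      simp [PiM, h1, h2, embed_apply_coe, div_eq_inv_mul]
  simp only [omegaM, htsum, Finset.mul_sum]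
  rw [Finset.sum_comm]
  refine Finset.sum_congr rfl fun i _ => ?_
  by_cases h : |((i : ℤ) : ℝ)| ≤ L
  · simp only [h, if_true, modCoeff, Finset.sum_mul]
    exact Finset.sum_congr rfl fun β _ => by ring
  · simp [h]

open Filter Asymptotics in
theorem eventually_log_bounds (σ p C : ℝ) {θ : ℝ} (hθ : θ < 1) :
    ∀ᶠ x : ℝ in atTop, 4 ≤ x ∧ 1 ≤ Real.log x ∧ 2 * σ * x ^ θ ≤ x / 10 ∧
      C + p * Real.log x ≤ x / 20 := by
  have h1 : (fun x : ℝ => 2 * σ * x ^ θ) =o[atTop] fun x => x := by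
    refine IsLittleO.const_mul_left ?_ _
    refine (isLittleO_iff_tendsto' ?_).mpr ?_
    · filter_upwards [eventually_gt_atTop 0] with x hx h
      exact absurd h hx.ne'
    · refine (tendsto_rpow_neg_atTop (sub_pos.mpr hθ)).congr' ?_
      filter_upwards [eventually_gt_atTop 0] with x hx
      rw [neg_sub, Real.rpow_sub_one hx.ne']
  have h2 : (fun x : ℝ => C + p * Real.log x) =o[atTop] fun x => x :=
    (isLittleO_const_id_atTop C).add (Real.isLittleO_log_id_atTop.const_mul_left p)
  filter_upwards [eventually_ge_atTop 4, Real.tendsto_log_atTop.eventually_ge_atTop 1,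
    h1.bound (by norm_num : (0 : ℝ) < 1 / 10), h2.bound (by norm_num : (0 : ℝ) < 1 / 20)]
    with x hx4 hxl hx1 hx2
  rw [Real.norm_of_nonneg (by linarith : (0 : ℝ) ≤ x)] at hx1 hx2
  exact ⟨hx4, hxl, by linarith [Real.le_norm_self (2 * σ * x ^ θ)],
    by linarith [Real.le_norm_self (C + p * Real.log x)]⟩

theorem exists_parameter_bounds {σ θ : ℝ} (hσ : 0 < σ) (hθ : θ ∈ Set.Ioo (0 : ℝ) 1) :
    ∃ εs : ℝ, 0 < εs ∧ ∀ ε : ℝ, 0 < ε → ε < εs →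
      18 * (rEps σ θ ε : ℝ) ≤ LEps σ θ ε ∧ LEps σ θ ε ≤ Real.log ε⁻¹ ^ (1 + 4 / θ) ∧
      1 ≤ Real.log ε⁻¹ ^ (1 + 4 / θ) ∧
      ∀ n : ℝ, 0 ≤ n → n ≤ 3 * Real.log ε⁻¹ ^ (1 + 4 / θ) →
        3 * (rEps σ θ ε : ℝ) * (4 * LEps σ θ ε + 2) ^ (6 * rEps σ θ ε) *
          (64 * n ^ 2 * Real.exp (σ * (18 * (rEps σ θ ε : ℝ)) ^ θ) ^ 2 * (10 * dEps ε) *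
            (2 * LEps σ θ ε) ^ (12 * rEps σ θ ε) / (ε / 2) ^ 2) ≤ ε ^ ((1 : ℝ) / 6) := by
  obtain ⟨hθ0, hθ1⟩ := hθ
  set p : ℝ := 1 + 4 / θ with hp
  obtain ⟨x₀, hx₀⟩ := Filter.eventually_atTop.mp
    (eventually_log_bounds σ (3 * p) (Real.log 23040) hθ1)
  refine ⟨Real.exp (-x₀), Real.exp_pos _, fun ε hε0 hε => ?_⟩
  set x : ℝ := Real.log ε⁻¹ with hx
  have hεx : ε = Real.exp (-x) := by rw [hx, Real.log_inv, neg_neg, Real.exp_log hε0]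
  have hxx₀ : x₀ ≤ x := by
    rw [hεx, Real.exp_lt_exp] at hε
    linarith
  obtain ⟨hx4, hlog, hσx, hC⟩ := hx₀ x hxx₀
  have hx0 : 0 < x := by linarith
  set r : ℕ := rEps σ θ ε with hr
  have hrlog : (r : ℝ) * Real.log x ≤ θ * (1 - θ) / 500 * x := by
    have hm0 : 0 < min 1 σ := lt_min one_pos hσ
    have h1θ : 0 < 1 - θ := by linarith
    have h1 : (r : ℝ) ≤ (min 1 σ * θ * (1 - θ) / 500) * x / Real.log x :=
      Nat.floor_le (by positivity)
    rw [le_div_iff₀ (by linarith)] at h1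
    refine h1.trans ?_
    have : min 1 σ * θ * (1 - θ) ≤ θ * (1 - θ) := by
      rw [mul_assoc]
      exact mul_le_of_le_one_left (by positivity) (min_le_left _ _)
    gcongr
  have hr0 : (0 : ℝ) ≤ r := Nat.cast_nonneg r
  have hrx : (r : ℝ) ≤ x / 2000 := by
    nlinarith [mul_le_mul_of_nonneg_left hlog hr0, sq_nonneg (θ - 1 / 2)]
  have hrp : 18 * (r : ℝ) * (p * Real.log x) ≤ 0.144 * x := by
    have h1 : p * (θ * (1 - θ)) ≤ 4 := by
      rw [hp]
      field_simp
      nlinarith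
    have hp0 : 0 < p := by positivity
    nlinarith [mul_le_mul_of_nonneg_left hrlog hp0.le]
  set M : ℝ := x ^ p with hM
  have hN : NEps θ ε ^ 2 = x ^ (4 / θ) := by
    rw [NEps, ← Real.rpow_natCast, ← Real.rpow_mul hx0.le]
    congr 1
    push_cast
    ring
  have hMx : M = x * x ^ (4 / θ) := by rw [hM, hp, Real.rpow_add hx0, Real.rpow_one]
  have hNx : x ≤ x ^ (4 / θ) :=
    Real.self_le_rpow_of_one_le (by linarith) (by rw [le_div_iff₀ hθ0]; linarith)
  have hMx' : x ≤ M := by nlinarith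
  have hL : LEps σ θ ε = 6 * (r : ℝ) * x ^ (4 / θ) := by rw [LEps, hN]
  set L : ℝ := LEps σ θ ε with hLdef
  have hL0 : 0 ≤ L := by rw [hL]; positivity
  have hLM : L ≤ M / 300 := by
    rw [hL, hMx]
    nlinarith
  refine ⟨?_, by linarith, by linarith, fun n hn0 hn => ?_⟩
  · rw [hL]
    nlinarith
  have hMexp : M = Real.exp (p * Real.log x) := by rw [hM, Real.rpow_def_of_pos hx0, mul_comm]
  have hpow : (4 * L + 2) ^ (6 * r) * (2 * L) ^ (12 * r) ≤ Real.exp (0.144 * x) := by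
    calc (4 * L + 2) ^ (6 * r) * (2 * L) ^ (12 * r) ≤ M ^ (6 * r) * M ^ (12 * r) := by
          gcongr <;> linarith
      _ = Real.exp (18 * (r : ℝ) * (p * Real.log x)) := by
          rw [← pow_add, hMexp, ← Real.exp_nat_mul]
          congr 1
          push_cast
          ring
      _ ≤ _ := Real.exp_le_exp.mpr hrp
  have hw : Real.exp (σ * (18 * (r : ℝ)) ^ θ) ^ 2 ≤ Real.exp (x / 10) := by
    rw [← Real.exp_nat_mul, Real.exp_le_exp]
    have : (18 * (r : ℝ)) ^ θ ≤ x ^ θ := by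
      gcongr
      linarith
    push_cast
    nlinarith
  have hM3 : 23040 * M ^ 3 ≤ Real.exp (x / 20) := by
    rw [hMexp, ← Real.exp_nat_mul, ← Real.exp_log (by norm_num : (0 : ℝ) < 23040), ← Real.exp_add,
      Real.exp_le_exp]
    push_cast
    linarith
  have hd : dEps ε / ε ^ 2 = Real.exp (-(x / 2)) := by
    rw [dEps, hεx, ← Real.exp_mul, ← Real.exp_nat_mul, ← Real.exp_sub]
    congr 1
    push_cast
    ring
  have hε6 : ε ^ ((1 : ℝ) / 6) = Real.exp (-(x / 6)) := by
    rw [hεx, ← Real.exp_mul]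
    congr 1
    ring
  rw [hε6]
  calc 3 * (r : ℝ) * (4 * L + 2) ^ (6 * r) *
          (64 * n ^ 2 * Real.exp (σ * (18 * (r : ℝ)) ^ θ) ^ 2 * (10 * dEps ε) *
            (2 * L) ^ (12 * r) / (ε / 2) ^ 2)
      = 2560 * (3 * (r : ℝ)) * n ^ 2 * ((4 * L + 2) ^ (6 * r) * (2 * L) ^ (12 * r)) *
          Real.exp (σ * (18 * (r : ℝ)) ^ θ) ^ 2 * (dEps ε / ε ^ 2) := by
        field_simp
        ring
    _ ≤ 2560 * M * (3 * M) ^ 2 * Real.exp (0.144 * x) * Real.exp (x / 10) *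
          Real.exp (-(x / 2)) := by
        rw [hd]
        gcongr
        linarith
    _ = 23040 * M ^ 3 * Real.exp (0.144 * x) * Real.exp (x / 10) * Real.exp (-(x / 2)) := by ring
    _ ≤ Real.exp (x / 20) * Real.exp (0.144 * x) * Real.exp (x / 10) * Real.exp (-(x / 2)) := by
        gcongr
    _ ≤ Real.exp (-(x / 6)) := by
        rw [← Real.exp_add, ← Real.exp_add, ← Real.exp_add, Real.exp_le_exp]
        linarith

theorem gNorm_embed_lt_iff (σ θ M ε : ℝ) (v : ↥(Finset.Icc (-(Kfl M)) (Kfl M)) → ℂ) :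
    gNorm σ θ (embed M v) < ε ↔
      ∑ i : ↥(Finset.Icc (-(Kfl M)) (Kfl M)), wt σ θ i * ‖v i‖ < ε / 2 := by
  rw [gNorm_embed, lt_div_iff₀' two_pos]

theorem volume_small_omegaM_le {σ θ L M D ε : ℝ} {r m : ℕ} (hσ : 0 < σ) (hθ : 0 < θ)
    (hD : 0 ≤ D) (hε : 0 < ε) (hrL : 18 * (r : ℝ) ≤ L) (hLM : L ≤ M) (hm : 1 ≤ m)
    (hmr : m ≤ 3 * r) {j : Fin (2 * m) → ℤ × ℤ} (hR : inR j) (hj : ¬ integ j)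
    (hjL : ∀ β, (brk ((j β).2) : ℝ) ≤ L) :
    volume {v : ↥(Finset.Icc (-(Kfl M)) (Kfl M)) → ℂ |
        gNorm σ θ (embed M v) < ε ∧ |omegaM L j (PiM L (embed M v))| ≤ D} ≤
      ENNReal.ofReal (64 * (Fintype.card ↥(Finset.Icc (-(Kfl M)) (Kfl M)) : ℝ) ^ 2 *
          Real.exp (σ * (18 * (r : ℝ)) ^ θ) ^ 2 * D * (2 * L) ^ (12 * r) / (ε / 2) ^ 2) *
        volume {v : ↥(Finset.Icc (-(Kfl M)) (Kfl M)) → ℂ | gNorm σ θ (embed M v) < ε} := by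
  have hmR : (m : ℝ) ≤ 3 * r := by exact_mod_cast hmr
  have hm1 : (1 : ℝ) ≤ m := by exact_mod_cast hm
  have hL1 : 1 ≤ 2 * L := by linarith
  have habs : ∀ β, |((j β).2 : ℝ)| ≤ L := fun β => by
    refine le_trans ?_ (hjL β)
    rw [← Int.cast_abs, ← Int.natCast_natAbs, Int.cast_natCast]
    exact_mod_cast le_max_right 1 _
  obtain ⟨a, ha0, ha6, hcoef⟩ := exists_modCoeff_lower_bound hR.1.1 hj hL1
    (by push_cast; linarith) habs
  have ha0' : (0 : ℝ) ≤ a := by exact_mod_cast ha0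
  have ha18 : (a : ℝ) ≤ 18 * r := by
    have : (a : ℝ) ≤ 3 * ((2 * m : ℕ) : ℝ) := by exact_mod_cast ha6
    push_cast at this
    linarith
  have haL : |(a : ℝ)| ≤ L := by rw [abs_of_nonneg ha0']; linarith
  have haM : a ≤ Kfl M := Int.le_floor.mpr (by linarith)
  have hamem : a ∈ Finset.Icc (-(Kfl M)) (Kfl M) := Finset.mem_Icc.mpr ⟨by omega, haM⟩
  have hc0 : modCoeff j a ≠ 0 := by
    intro h
    rw [h, abs_zero, zero_mul] at hcoef
    linarith
  have hc : 1 / |modCoeff j a| ≤ (2 * L) ^ (12 * r) := by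
    rw [div_le_iff₀' (abs_pos.mpr hc0)]
    refine hcoef.trans ?_
    exact mul_le_mul_of_nonneg_left (pow_le_pow_right₀ hL1 (by omega)) (abs_nonneg _)
  have key := volume_quadratic_le_weighted_ball
    (w := fun i : ↥(Finset.Icc (-(Kfl M)) (Kfl M)) => wt σ θ i)
    (c := fun i => if |((i : ℤ) : ℝ)| ≤ L then modCoeff j i else 0) (i := ⟨a, hamem⟩)
    (fun _ => Real.exp_pos _) (by simpa only [haL, if_true] using hc0) (half_pos hε) hD
  simp only [haL, if_true] at key
  simp only [gNorm_embed_lt_iff, omegaM_PiM_embed]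
  refine key.trans (mul_le_mul_left (ENNReal.ofReal_le_ofReal ?_) _)
  have hwt : wt σ θ a ≤ Real.exp (σ * (18 * (r : ℝ)) ^ θ) := by
    rw [wt, abs_of_nonneg ha0']
    gcongr
  have hwt0 : 0 < wt σ θ a := Real.exp_pos _
  calc 64 * (Fintype.card ↥(Finset.Icc (-(Kfl M)) (Kfl M)) : ℝ) ^ 2 * wt σ θ a ^ 2 * D /
        (|modCoeff j a| * (ε / 2) ^ 2)
      = 64 * (Fintype.card ↥(Finset.Icc (-(Kfl M)) (Kfl M)) : ℝ) ^ 2 * wt σ θ a ^ 2 * D *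
        (1 / |modCoeff j a|) / (ε / 2) ^ 2 := by
        have := abs_pos.mpr hc0
        field_simp
    _ ≤ _ := by gcongr

/-- The multi-indices with signs `±1`, `2 * m` entries and modes in `[-K, K]`. -/
def boxIndices (K : ℤ) (m : ℕ) : Finset (Fin (2 * m) → ℤ × ℤ) :=
  Fintype.piFinset fun _ => ({1, -1} : Finset ℤ) ×ˢ Finset.Icc (-K) K

theorem card_boxIndices_le {L : ℝ} (hL : 0 ≤ L) {m r : ℕ} (hmr : m ≤ 3 * r) :
    ((boxIndices (Kfl L) m).card : ℝ) ≤ (4 * L + 2) ^ (6 * r) := by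
  have hK0 : 0 ≤ Kfl L := Int.floor_nonneg.mpr hL
  have hKL : (Kfl L : ℝ) ≤ L := Int.floor_le L
  have hcard : ((Finset.Icc (-(Kfl L)) (Kfl L)).card : ℝ) = 2 * Kfl L + 1 := by
    have : ((Finset.Icc (-(Kfl L)) (Kfl L)).card : ℤ) = 2 * Kfl L + 1 := by
      rw [Int.card_Icc]
      omega
    exact_mod_cast this
  rw [boxIndices, Fintype.card_piFinset]
  simp only [Finset.card_product, Finset.prod_const, Finset.card_univ, Fintype.card_fin]
  rw [show ({1, -1} : Finset ℤ).card = 2 from rfl]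
  push_cast
  rw [hcard]
  have hK0' : (0 : ℝ) ≤ Kfl L := by exact_mod_cast hK0
  calc (2 * (2 * (Kfl L : ℝ) + 1)) ^ (2 * m) ≤ (4 * L + 2) ^ (2 * m) := by
        gcongr
        linarith
    _ ≤ (4 * L + 2) ^ (6 * r) := pow_le_pow_right₀ (by linarith) (by omega)

theorem mem_boxIndices {L : ℝ} {m : ℕ} {j : Fin (2 * m) → ℤ × ℤ} (hU : isU2 j)
    (hj : ∀ β, (brk ((j β).2) : ℝ) ≤ L) : j ∈ boxIndices (Kfl L) m := by
  rw [boxIndices, Fintype.mem_piFinset]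
  intro β
  rw [Finset.mem_product, Finset.mem_Icc, Finset.mem_insert, Finset.mem_singleton]
  have h : ((brk ((j β).2) : ℤ) : ℝ) ≤ L := by exact_mod_cast hj β
  have h' : (brk ((j β).2) : ℤ) ≤ Kfl L := Int.le_floor.mpr h
  have h'' : (j β).2.natAbs ≤ brk ((j β).2) := le_max_right _ _
  exact ⟨hU β, by omega, by omega⟩

theorem volume_not_inTheta_le {σ θ ε M : ℝ} (hσ : 0 < σ) (hθ : 0 < θ) (hε : 0 < ε)
    (hrL : 18 * (rEps σ θ ε : ℝ) ≤ LEps σ θ ε) (hLM : LEps σ θ ε ≤ M) :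
    volume {v : ↥(Finset.Icc (-(Kfl M)) (Kfl M)) → ℂ |
        gNorm σ θ (embed M v) < ε ∧ ¬ inTheta σ θ ε (embed M v)} ≤
      ENNReal.ofReal (3 * (rEps σ θ ε : ℝ) * (4 * LEps σ θ ε + 2) ^ (6 * rEps σ θ ε) *
          (64 * (Fintype.card ↥(Finset.Icc (-(Kfl M)) (Kfl M)) : ℝ) ^ 2 *
            Real.exp (σ * (18 * (rEps σ θ ε : ℝ)) ^ θ) ^ 2 * (10 * dEps ε) *
            (2 * LEps σ θ ε) ^ (12 * rEps σ θ ε) / (ε / 2) ^ 2)) *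
        volume {v : ↥(Finset.Icc (-(Kfl M)) (Kfl M)) → ℂ | gNorm σ θ (embed M v) < ε} := by
  set r := rEps σ θ ε
  set L := LEps σ θ ε
  have hL0 : 0 ≤ L := le_trans (by positivity) hrL
  have hd : 0 ≤ 10 * dEps ε := mul_nonneg (by norm_num) (Real.rpow_nonneg hε.le _)
  set B := volume {v : ↥(Finset.Icc (-(Kfl M)) (Kfl M)) → ℂ | gNorm σ θ (embed M v) < ε}
  set κ : ℝ := 64 * (Fintype.card ↥(Finset.Icc (-(Kfl M)) (Kfl M)) : ℝ) ^ 2 *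
    Real.exp (σ * (18 * (r : ℝ)) ^ θ) ^ 2 * (10 * dEps ε) * (2 * L) ^ (12 * r) / (ε / 2) ^ 2
  set J : (m : ℕ) → Finset (Fin (2 * m) → ℤ × ℤ) := fun m =>
    (boxIndices (Kfl L) m).filter fun j => inR j ∧ ¬ integ j ∧ ∀ β, (brk ((j β).2) : ℝ) ≤ L
  set bad : (m : ℕ) → (Fin (2 * m) → ℤ × ℤ) → Set (↥(Finset.Icc (-(Kfl M)) (Kfl M)) → ℂ) :=
    fun m j => {v | gNorm σ θ (embed M v) < ε ∧ |omegaM L j (PiM L (embed M v))| ≤ 10 * dEps ε}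
  have hsub : {v : ↥(Finset.Icc (-(Kfl M)) (Kfl M)) → ℂ |
      gNorm σ θ (embed M v) < ε ∧ ¬ inTheta σ θ ε (embed M v)} ⊆
      ⋃ m ∈ Finset.Icc 1 (3 * r), ⋃ j ∈ J m, bad m j := by
    rintro v ⟨hv, hΘ⟩
    simp only [inTheta, inV, not_forall, not_lt] at hΘ
    obtain ⟨m, hm, j, hR, hj, hmr, hjL, hω⟩ := hΘ
    have hmr' : m ≤ 3 * r := by
      have : (m : ℝ) ≤ 3 * r := by linarith
      exact_mod_cast this
    simp only [Set.mem_iUnion]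
    exact ⟨m, Finset.mem_Icc.mpr ⟨hm, hmr'⟩, j,
      Finset.mem_filter.mpr ⟨mem_boxIndices hR.1.1 hjL, hR, hj, hjL⟩, hv, hω⟩
  calc _ ≤ volume (⋃ m ∈ Finset.Icc 1 (3 * r), ⋃ j ∈ J m, bad m j) := measure_mono hsub
    _ ≤ ∑ m ∈ Finset.Icc 1 (3 * r), ∑ j ∈ J m, volume (bad m j) :=
        (measure_biUnion_finset_le _ _).trans
          (Finset.sum_le_sum fun m _ => measure_biUnion_finset_le _ _)
    _ ≤ ∑ m ∈ Finset.Icc 1 (3 * r), ENNReal.ofReal ((4 * L + 2) ^ (6 * r)) *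
          (ENNReal.ofReal κ * B) := by
        refine Finset.sum_le_sum fun m hm => ?_
        rw [Finset.mem_Icc] at hm
        calc ∑ j ∈ J m, volume (bad m j) ≤ ∑ j ∈ J m, ENNReal.ofReal κ * B := by
              refine Finset.sum_le_sum fun j hj => ?_
              obtain ⟨-, hR, hj, hjL⟩ := Finset.mem_filter.mp hj
              exact volume_small_omegaM_le hσ hθ hd hε hrL hLM hm.1 hm.2 hR hj hjL
          _ = ENNReal.ofReal ((J m).card : ℝ) * (ENNReal.ofReal κ * B) := by
              rw [Finset.sum_const, nsmul_eq_mul, ENNReal.ofReal_natCast]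
          _ ≤ _ := by
              gcongr
              refine le_trans ?_ (card_boxIndices_le hL0 hm.2)
              exact_mod_cast Finset.card_filter_le _ _
    _ = _ := by
        rw [Finset.sum_const, Nat.card_Icc, Nat.add_sub_cancel, nsmul_eq_mul,
          ← ENNReal.ofReal_natCast, ← mul_assoc, ← mul_assoc,
          ← ENNReal.ofReal_mul (by positivity), ← ENNReal.ofReal_mul (by positivity)]
        push_cast
        rfl

/-- Measure estimate for `Θ_ε`: there is `ε* > 0` (depending only on
`σ, θ`) such that for `ε ∈ (0, ε*)` and `M_ε = (log ε⁻¹)^{1+4/θ}`, the Lebesgue measure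
of `Θ_ε ∩ 𝔹_{M_ε}(0, ε)` inside `𝒢_{M_ε}` is at least `(1 - ε^{1/6})` times that of
`𝔹_{M_ε}(0, ε)`. -/
theorem stmt2 (σ θ : ℝ) (hσ : 0 < σ) (hθ : θ ∈ Set.Ioo (0 : ℝ) 1) :
    ∃ εs : ℝ, 0 < εs ∧ ∀ ε : ℝ, 0 < ε → ε < εs →
      ENNReal.ofReal (1 - ε ^ ((1 : ℝ) / 6)) *
          volume {v : ↥(Finset.Icc (-(Kfl (Real.log ε⁻¹ ^ (1 + 4 / θ))))
                (Kfl (Real.log ε⁻¹ ^ (1 + 4 / θ)))) → ℂ |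
            gNorm σ θ (embed (Real.log ε⁻¹ ^ (1 + 4 / θ)) v) < ε} ≤
        volume {v : ↥(Finset.Icc (-(Kfl (Real.log ε⁻¹ ^ (1 + 4 / θ))))
                (Kfl (Real.log ε⁻¹ ^ (1 + 4 / θ)))) → ℂ |
            inTheta σ θ ε (embed (Real.log ε⁻¹ ^ (1 + 4 / θ)) v) ∧
            gNorm σ θ (embed (Real.log ε⁻¹ ^ (1 + 4 / θ)) v) < ε} := by
  obtain ⟨εs, hεs, h⟩ := exists_parameter_bounds hσ hθ
  refine ⟨εs, hεs, fun ε hε0 hε => ?_⟩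
  obtain ⟨hrL, hLM, hM1, hbound⟩ := h ε hε0 hε
  set M : ℝ := Real.log ε⁻¹ ^ (1 + 4 / θ)
  have hcard : (Fintype.card ↥(Finset.Icc (-(Kfl M)) (Kfl M)) : ℝ) ≤ 3 * M := by
    have hK0 : 0 ≤ Kfl M := Int.floor_nonneg.mpr (by linarith)
    have hKM : (Kfl M : ℝ) ≤ M := Int.floor_le M
    have : ((Fintype.card ↥(Finset.Icc (-(Kfl M)) (Kfl M)) : ℤ) : ℝ) =
        ((2 * Kfl M + 1 : ℤ) : ℝ) := by
      rw [Fintype.card_coe, Int.card_Icc]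
      congr 1
      omega
    push_cast at this
    linarith
  have hbad := (volume_not_inTheta_le hσ hθ.1 hε0 hrL hLM).trans
    (mul_le_mul_left (ENNReal.ofReal_le_ofReal (hbound _ (Nat.cast_nonneg _) hcard)) _)
  set B := {v : ↥(Finset.Icc (-(Kfl M)) (Kfl M)) → ℂ | gNorm σ θ (embed M v) < ε} with hB
  have hBfin : volume B ≠ ⊤ := by
    simp only [hB, gNorm_embed_lt_iff]
    exact (volume_weighted_ball_lt_top (fun i => Real.one_le_exp (by positivity)) _).ne
  rw [ENNReal.ofReal_sub _ (by positivity), ENNReal.sub_mul fun _ _ => hBfin, ENNReal.ofReal_one,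
    one_mul, tsub_le_iff_right]
  refine (measure_mono fun v hv => ?_).trans ((measure_union_le _ _).trans
    (add_le_add_right hbad _))
  by_cases hΘ : inTheta σ θ ε (embed M v)
  · exact Or.inl ⟨hΘ, hv⟩
  · exact Or.inr ⟨hv, hΘ⟩
end
end

section
/- Let m ≥ 2, let 𝐣 = (j₁,…,j_{2m}) ∈ R_m, and let ℓ ∈ ℤ. If the number of indices α with j_α = (1,ℓ) differs from the number of indices α with j_α = (−1,ℓ) (equivalently, if the Poisson bracket {I_ℓ, z_𝐣} does not vanish identically), then μ₃(𝐣) ≥ (⟨ℓ⟩/m)^{1/2}, where ⟨ℓ⟩ := max(1,|ℓ|). -/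
noncomputable section

attribute [local instance] Classical.propDecidable

open scoped BigOperators

/-- `mu k v` is the `k`-th largest value of `v` (for `1 ≤ k ≤ n`). -/
def mu {n : ℕ} (k : ℕ) (v : Fin n → ℕ) : ℕ :=
  if h : 1 ≤ k ∧ k ≤ n then v (Tuple.sort v ⟨n - k, by omega⟩) else 0


theorem exists_le_mu_three {n : ℕ} (hn : 3 ≤ n) (v : Fin n → ℕ) :
    ∃ p q : Fin n, p ≠ q ∧ ∀ α, α ≠ p → α ≠ q → v α ≤ mu 3 v := by
  refine ⟨Tuple.sort v ⟨n - 1, by omega⟩, Tuple.sort v ⟨n - 2, by omega⟩, ?_, ?_⟩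
  · intro h
    have := congrArg Fin.val ((Tuple.sort v).injective h)
    simp only at this
    omega
  · intro α hp hq
    obtain ⟨i, rfl⟩ := (Tuple.sort v).surjective α
    have hp' : i.val ≠ n - 1 := fun h => hp (congrArg _ (Fin.ext h))
    have hq' : i.val ≠ n - 2 := fun h => hq (congrArg _ (Fin.ext h))
    have hi : i ≤ ⟨n - 3, by omega⟩ := Fin.mk_le_mk.mpr (by have := i.isLt; omega)
    simpa only [mu, dif_pos (show 1 ≤ 3 ∧ 3 ≤ n by omega), Function.comp_apply] using
      Tuple.monotone_sort v hi

theorem le_mu {n k b : ℕ} (hk : 1 ≤ k ∧ k ≤ n) (v : Fin n → ℕ) (hv : ∀ α, b ≤ v α) :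
    b ≤ mu k v := by
  rw [mu, dif_pos hk]
  exact hv _

/-- If a family of integers sums to zero and all but two of its terms are bounded by `B`, then
the sum of these two terms is at most `(n - 2) B` in absolute value. -/
theorem abs_add_le_of_sum_eq_zero {n : ℕ} (f : Fin n → ℤ) (hf : ∑ α, f α = 0) {p q : Fin n}
    (hpq : p ≠ q) {B : ℤ} (hB : ∀ α, α ≠ p → α ≠ q → |f α| ≤ B) :
    |f p + f q| ≤ ((n : ℤ) - 2) * B := by
  classical
  have hq : q ∈ Finset.univ.erase p := by simp [hpq.symm]
  have hsum : f p + (f q + ∑ α ∈ (Finset.univ.erase p).erase q, f α) = 0 := by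
    rw [Finset.add_sum_erase _ f hq, Finset.add_sum_erase _ f (Finset.mem_univ p), hf]
  have hcard : (((Finset.univ.erase p).erase q).card : ℤ) = (n : ℤ) - 2 := by
    have h1 := Finset.card_erase_add_one hq
    have h2 := Finset.card_erase_add_one (Finset.mem_univ p)
    rw [Finset.card_univ, Fintype.card_fin] at h2
    omega
  have hle : |∑ α ∈ (Finset.univ.erase p).erase q, f α| ≤ ((n : ℤ) - 2) * B := by
    refine (Finset.abs_sum_le_sum_abs _ _).trans ?_
    rw [← hcard, ← nsmul_eq_mul]
    refine Finset.sum_le_card_nsmul _ _ _ fun α hα => ?_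
    simp only [Finset.mem_erase, Finset.mem_univ, and_true] at hα
    exact hB α hα.2 hα.1
  rwa [show f p + f q = -∑ α ∈ (Finset.univ.erase p).erase q, f α by linarith, abs_neg]

theorem abs_le_of_abs_sq_add_sq_le {m K a b : ℤ} (hm : 1 ≤ m) (hK : 1 ≤ K)
    (h : |a ^ 2 + b ^ 2| ≤ (2 * m - 2) * K ^ 2) : |a| ≤ m * K ^ 2 := by
  have h1 := (le_abs_self _).trans h
  have hK2 : 1 ≤ K ^ 2 := one_le_pow₀ hK
  refine abs_le_of_sq_le_sq ?_ (by positivity)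
  nlinarith [sq_nonneg b, sq_nonneg (m - 1), mul_nonneg (sq_nonneg m)
    (mul_nonneg (by linarith : 0 ≤ K ^ 2) (by linarith : 0 ≤ K ^ 2 - 1)),
    mul_nonneg (by linarith : 0 ≤ K ^ 2) (sq_nonneg (m - 1))]

theorem abs_le_of_abs_sq_sub_sq_le {m K a b : ℤ} (hm : 1 ≤ m) (hK : 1 ≤ K) (hab : a ≠ b)
    (h1 : |a - b| ≤ (2 * m - 2) * K) (h2 : |a ^ 2 - b ^ 2| ≤ (2 * m - 2) * K ^ 2) :
    |a| ≤ m * K ^ 2 := by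
  have hS : 1 ≤ |a - b| := Int.one_le_abs (sub_ne_zero.mpr hab)
  have hK2 : K ≤ K ^ 2 := by nlinarith
  have hSN : |a - b| ≤ (2 * m - 2) * K ^ 2 :=
    h1.trans (mul_le_mul_of_nonneg_left hK2 (by linarith))
  have hkey : 2 * (|a| * |a - b|) ≤ |a - b| ^ 2 + (2 * m - 2) * K ^ 2 := by
    have : 2 * (|a| * |a - b|) = |(a - b) ^ 2 + (a ^ 2 - b ^ 2)| := by
      rw [show (a - b) ^ 2 + (a ^ 2 - b ^ 2) = 2 * (a * (a - b)) by ring, abs_mul, abs_mul, abs_two]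
    rw [this]
    refine (abs_add_le _ _).trans ?_
    rw [abs_pow]
    linarith
  refine le_of_mul_le_mul_right ?_ (by linarith : 0 < |a - b|)
  nlinarith [mul_nonneg (sub_nonneg.mpr hS) (sub_nonneg.mpr hSN),
    mul_nonneg (by linarith : 0 ≤ |a - b|) (by linarith : 0 ≤ K ^ 2 - 1)]

/-- Two resonant entries dominating all others obey the quadratic bound, unless they cancel. -/
theorem abs_le_of_resonant_pair {m K d e a b : ℤ} (hm : 1 ≤ m) (hK : 1 ≤ K)
    (hd : d = 1 ∨ d = -1) (he : e = 1 ∨ e = -1) (hne : ¬ (d = -e ∧ a = b))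
    (h1 : |d * a + e * b| ≤ (2 * m - 2) * K)
    (h2 : |d * a ^ 2 + e * b ^ 2| ≤ (2 * m - 2) * K ^ 2) : |a| ≤ m * K ^ 2 := by
  rcases hd with rfl | rfl <;> rcases he with rfl | rfl
  · exact abs_le_of_abs_sq_add_sq_le hm hK (b := b) (by simpa using h2)
  · refine abs_le_of_abs_sq_sub_sq_le hm hK (b := b) (by simpa using hne) ?_ ?_
    · simpa [sub_eq_add_neg] using h1
    · simpa [sub_eq_add_neg] using h2
  · refine abs_le_of_abs_sq_sub_sq_le hm hK (b := b) (by simpa using hne) ?_ ?_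
    · rw [abs_sub_comm]; simpa [sub_eq_add_neg, add_comm] using h1
    · rw [abs_sub_comm]; simpa [sub_eq_add_neg, add_comm] using h2
  · refine abs_le_of_abs_sq_add_sq_le hm hK (b := b) ?_
    rw [← abs_neg]; simpa [add_comm] using h2

/-- If `ℓ` occurs only at two positions, with opposite signs, then it occurs exactly once with each
sign. -/
theorem card_filter_eq_of_cancelling_pair {n : ℕ} (j : Fin n → ℤ × ℤ) (ℓ : ℤ) {p q : Fin n}
    (hp : (j p).2 = ℓ) (hq : (j q).2 = ℓ) (hδ : (j p).1 = -(j q).1)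
    (hsign : (j q).1 = 1 ∨ (j q).1 = -1) (h : ∀ α, (j α).2 = ℓ → α = p ∨ α = q) :
    (Finset.univ.filter fun α => j α = ((1 : ℤ), ℓ)).card =
      (Finset.univ.filter fun α => j α = ((-1 : ℤ), ℓ)).card := by
  have key : ∀ s : ℤ, ∀ u w : Fin n, (j u).2 = ℓ → (j u).1 = s → (j w).1 ≠ s →
      (∀ α, (j α).2 = ℓ → α = u ∨ α = w) →
      (Finset.univ.filter fun α => j α = (s, ℓ)).card = 1 := by
    intro s u w hu hus hws huw
    refine Finset.card_eq_one.mpr ⟨u, ?_⟩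
    ext α
    simp only [Finset.mem_filter, Finset.mem_univ, true_and, Finset.mem_singleton]
    constructor
    · intro hα
      refine (huw α (by rw [hα])).resolve_right ?_
      rintro rfl
      exact hws (by rw [hα])
    · rintro rfl
      exact Prod.ext hus hu
  have h' : ∀ α, (j α).2 = ℓ → α = q ∨ α = p := fun α hα => (h α hα).symm
  rcases hsign with hs | hs
  · rw [key 1 q p hq hs (by omega) h', key (-1) p q hp (by omega) (by omega) h]
  · rw [key 1 p q hp (by omega) (by omega) h, key (-1) q p hq hs (by omega) h']

/-- **Statement 5.** Let `m ≥ 2`, `𝐣 ∈ R_m` and `ℓ ∈ ℤ`. If the number of entries of `𝐣`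
equal to `(1,ℓ)` differs from the number of entries equal to `(-1,ℓ)` (i.e. `{I_ℓ, z_𝐣} ≠ 0`),
then `μ₃(𝐣) ≥ (⟨ℓ⟩/m)^{1/2}`. -/
theorem stmt5 (m : ℕ) (hm : 2 ≤ m) (j : Fin (2 * m) → ℤ × ℤ) (hj : inR j) (ℓ : ℤ)
    (hne : (Finset.univ.filter fun α => j α = ((1 : ℤ), ℓ)).card ≠
           (Finset.univ.filter fun α => j α = ((-1 : ℤ), ℓ)).card) :
    Real.sqrt ((brk ℓ : ℝ) / (m : ℝ)) ≤ (mu 3 (fun α => brk ((j α).2)) : ℝ) := by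
  obtain ⟨⟨hU, -, hmom⟩, hres⟩ := hj
  set v : Fin (2 * m) → ℕ := fun α => brk ((j α).2)
  have hK : 1 ≤ mu 3 v := le_mu ⟨by omega, by omega⟩ v fun α => le_max_left _ _
  obtain ⟨p, q, hpq, hle⟩ := exists_le_mu_three (by omega : 3 ≤ 2 * m) v
  set K := mu 3 v
  have habs : ∀ α, α ≠ p → α ≠ q → |(j α).2| ≤ (K : ℤ) := fun α h1 h2 => by
    have h3 : (j α).2.natAbs ≤ K := (le_max_right _ _).trans (hle α h1 h2)
    rw [Int.abs_eq_natAbs]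
    exact_mod_cast h3
  have hδ : ∀ α, |(j α).1| = 1 := fun α => by rcases hU α with h | h <;> simp [h]
  have hn : ((2 * m : ℕ) : ℤ) - 2 = 2 * (m : ℤ) - 2 := by push_cast; ring
  have h1 := abs_add_le_of_sum_eq_zero _ hmom hpq (B := (K : ℤ)) fun α hp hq => by
    rw [abs_mul, hδ, one_mul]
    exact habs α hp hq
  have h2 := abs_add_le_of_sum_eq_zero _ hres hpq (B := (K : ℤ) ^ 2) fun α hp hq => by
    rw [abs_mul, hδ, one_mul, abs_pow]
    exact pow_le_pow_left₀ (abs_nonneg _) (habs α hp hq) 2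
  rw [hn] at h1 h2
  have hm1 : (1 : ℤ) ≤ m := by omega
  have hK1 : (1 : ℤ) ≤ K := by omega
  have hKsq : (K : ℤ) ≤ m * (K : ℤ) ^ 2 := by nlinarith
  have hℓ : |ℓ| ≤ (m : ℤ) * (K : ℤ) ^ 2 := by
    by_cases hsmall : |ℓ| ≤ (K : ℤ)
    · exact hsmall.trans hKsq
    have hocc : ∀ α, (j α).2 = ℓ → α = p ∨ α = q := by
      intro α hα
      by_contra! hcon
      exact hsmall (hα ▸ habs α hcon.1 hcon.2)
    have hcancel : ¬ ((j p).1 = -(j q).1 ∧ (j p).2 = ℓ ∧ (j q).2 = ℓ) := fun h =>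
      hne (card_filter_eq_of_cancelling_pair j ℓ h.2.1 h.2.2 h.1 (hU q) hocc)
    have hex : ∃ α, (j α).2 = ℓ := by
      by_contra! hcon
      refine hne ?_
      rw [Finset.filter_false_of_mem fun α _ h => hcon α (by rw [h]),
        Finset.filter_false_of_mem fun α _ h => hcon α (by rw [h])]
    obtain ⟨α, hα⟩ := hex
    rcases hocc α hα with rfl | rfl
    · rw [← hα]
      exact abs_le_of_resonant_pair hm1 hK1 (hU α) (hU q)
        (fun h => hcancel ⟨h.1, hα, h.2.symm.trans hα⟩) h1 h2
    · rw [← hα]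
      refine abs_le_of_resonant_pair hm1 hK1 (hU α) (hU p)
        (fun h => hcancel ⟨by linarith [h.1], h.2.symm.trans hα, hα⟩) ?_ ?_
      · rwa [add_comm]
      · rwa [add_comm]
  have hbrk : (brk ℓ : ℤ) ≤ (m : ℤ) * (K : ℤ) ^ 2 := by
    rw [brk, Nat.cast_max, Int.natCast_natAbs]
    exact max_le (by exact_mod_cast hK1.trans hKsq) hℓ
  refine Real.sqrt_le_iff.mpr ⟨Nat.cast_nonneg _, ?_⟩
  rw [div_le_iff₀ (by positivity), mul_comm]
  exact_mod_cast hbrk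
end
end

section
/- Let m, m' ≥ 1, P ∈ H_m and P' ∈ H_{m'}. Then there exists P'' ∈ H_{m''} with m'' = m + m' − 1 such that {P, P'}(z) = P''(z) for all z ∈ 𝒢, and ‖P''‖_{ℓ∞} ≤ 4 m m' ‖P‖_{ℓ∞} ‖P'‖_{ℓ∞}. -/
noncomputable section

attribute [local instance] Classical.propDecidable

open scoped BigOperators

/-- The `ℓ∞` norm of the coefficients of a polynomial. -/
def supNorm {n : ℕ} (P : (Fin n → ℤ × ℤ) → ℂ) : ℝ := ⨆ j, ‖P j‖

/-- Membership in `H_m` (with `n = 2m`): reality, symmetry, finite `ℓ∞` norm and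
support in the zero-momentum multi-indices `M_m`. -/
def inH {n : ℕ} (P : (Fin n → ℤ × ℤ) → ℂ) : Prop :=
  (∀ j : Fin n → ℤ × ℤ, (starRingEnd ℂ) (P j) = P (fun α => (-(j α).1, (j α).2))) ∧
  (∀ (j : Fin n → ℤ × ℤ) (φ : Equiv.Perm (Fin n)), P (j ∘ φ) = P j) ∧
  BddAbove (Set.range fun j => ‖P j‖) ∧
  (∀ j : Fin n → ℤ × ℤ, P j ≠ 0 → inM j)

/-- The Wirtinger partial derivative `∂P/∂z_p` of the polynomial with coefficients `P`,
for `p = (δ, a) ∈ 𝕌₂×ℤ`. -/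
def pderiv {n : ℕ} (P : (Fin n → ℤ × ℤ) → ℂ) (z : ℤ → ℂ) (p : ℤ × ℤ) : ℂ :=
  ∑' j : Fin n → ℤ × ℤ, P j *
    ∑ α : Fin n, if j α = p then ∏ β ∈ Finset.univ.erase α, idxVal z (j β) else 0

/-- The Poisson bracket
`{P, Q} = i ∑_{j ∈ 𝕌₂×ℤ} δ(j) (∂P/∂z_j) (∂Q/∂z_{j̄})`. -/
def pbracket {n n' : ℕ} (P : (Fin n → ℤ × ℤ) → ℂ) (Q : (Fin n' → ℤ × ℤ) → ℂ)
    (z : ℤ → ℂ) : ℂ :=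
  Complex.I * ∑' a : ℤ,
    (pderiv P z ((1 : ℤ), a) * pderiv Q z ((-1 : ℤ), a) -
      pderiv P z ((-1 : ℤ), a) * pderiv Q z ((1 : ℤ), a))

/-- The entrywise conjugate of a multi-index. -/
def conjIdx {n : ℕ} (j : Fin n → ℤ × ℤ) : Fin n → ℤ × ℤ := fun α => (-(j α).1, (j α).2)

theorem conjIdx_cons {n : ℕ} (d a : ℤ) (k : Fin n → ℤ × ℤ) :
    conjIdx (Fin.cons (d, a) k : Fin (n + 1) → ℤ × ℤ) = Fin.cons (-d, a) (conjIdx k) := by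
  funext α
  refine Fin.cases ?_ (fun i => ?_) α <;> simp [conjIdx]

theorem inM_comp_perm_iff {n : ℕ} (j : Fin n → ℤ × ℤ) (φ : Equiv.Perm (Fin n)) :
    inM (j ∘ φ) ↔ inM j := by
  have h₁ : ∑ α, ((j ∘ φ) α).1 = ∑ α, (j α).1 := Equiv.sum_comp φ fun α => (j α).1
  have h₂ : ∑ α, ((j ∘ φ) α).1 * ((j ∘ φ) α).2 = ∑ α, (j α).1 * (j α).2 :=
    Equiv.sum_comp φ fun α => (j α).1 * (j α).2
  have h₃ : isU2 (j ∘ φ) ↔ isU2 j := φ.forall_congr_left.trans (by simp [isU2])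
  rw [inM, inM, h₁, h₂, h₃]

theorem zProd_comp_perm {n : ℕ} (z : ℤ → ℂ) (j : Fin n → ℤ × ℤ) (φ : Equiv.Perm (Fin n)) :
    zProd z (j ∘ φ) = zProd z j :=
  Equiv.prod_comp φ fun α => idxVal z (j α)

theorem zProd_append {n n' : ℕ} (z : ℤ → ℂ) (k : Fin n → ℤ × ℤ) (l : Fin n' → ℤ × ℤ) :
    zProd z (Fin.append k l) = zProd z k * zProd z l := by
  simp [zProd, Fin.prod_univ_add]

theorem norm_le_supNorm {n : ℕ} {P : (Fin n → ℤ × ℤ) → ℂ} (hP : inH P) (j : Fin n → ℤ × ℤ) :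
    ‖P j‖ ≤ supNorm P :=
  le_ciSup hP.2.2.1 j

theorem supNorm_nonneg {n : ℕ} (P : (Fin n → ℤ × ℤ) → ℂ) : 0 ≤ supNorm P :=
  Real.iSup_nonneg fun _ => norm_nonneg _

/-- The modulus of the variable attached to an index, extended by `0` outside `𝕌₂ × ℤ`. -/
def idxAbs (z : ℤ → ℂ) (p : ℤ × ℤ) : ℝ := if p.1 = 1 ∨ p.1 = -1 then ‖z p.2‖ else 0

theorem idxAbs_nonneg (z : ℤ → ℂ) (p : ℤ × ℤ) : 0 ≤ idxAbs z p := by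
  unfold idxAbs
  split_ifs <;> simp

theorem prod_idxAbs_nonneg {n : ℕ} (z : ℤ → ℂ) (k : Fin n → ℤ × ℤ) :
    0 ≤ ∏ α, idxAbs z (k α) :=
  Finset.prod_nonneg fun _ _ => idxAbs_nonneg z _

theorem norm_zProd_of_isU2 {n : ℕ} (z : ℤ → ℂ) {k : Fin n → ℤ × ℤ} (hk : isU2 k) :
    ‖zProd z k‖ = ∏ α, idxAbs z (k α) := by
  rw [zProd, norm_prod]
  refine Finset.prod_congr rfl fun α _ => ?_
  rw [idxAbs, if_pos (hk α), idxVal]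
  split_ifs <;> simp

theorem summable_norm_of_inG {σ θ : ℝ} (hσ : 0 < σ) {z : ℤ → ℂ} (hz : inG σ θ z) :
    Summable fun a => ‖z a‖ := by
  refine Summable.of_nonneg_of_le (fun _ => norm_nonneg _) (fun a => ?_) hz
  exact le_mul_of_one_le_left (norm_nonneg _) (Real.one_le_exp (by positivity))

theorem summable_idxAbs {z : ℤ → ℂ} (hz : Summable fun a => ‖z a‖) :
    Summable (idxAbs z) := by
  have hd : Summable fun d : ℤ => if d = 1 ∨ d = -1 then (1 : ℝ) else 0 := by
    refine summable_of_ne_finset_zero (s := {1, -1}) fun d hd => ?_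
    simpa using hd
  refine (hd.mul_of_nonneg hz (fun d => ?_) fun _ => norm_nonneg _).congr fun p => ?_
  · dsimp only
    split_ifs <;> simp
  · simp [idxAbs]

theorem summable_prod_idxAbs {z : ℤ → ℂ} (hz : Summable fun a => ‖z a‖) (n : ℕ) :
    Summable fun k : Fin n → ℤ × ℤ => ∏ α, idxAbs z (k α) := by
  induction n with
  | zero => exact Summable.of_finite
  | succ n ih =>
    rw [← (Fin.consEquiv fun _ => ℤ × ℤ).summable_iff]
    refine ((summable_idxAbs hz).mul_of_nonneg ih (idxAbs_nonneg z)
      (prod_idxAbs_nonneg z)).congr fun x => ?_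
    simp [Fin.prod_univ_succ, Fin.consEquiv]

theorem inM_cons_iff {n : ℕ} (d a : ℤ) (k : Fin n → ℤ × ℤ) :
    inM (Fin.cons (d, a) k : Fin (n + 1) → ℤ × ℤ) ↔ ((d = 1 ∨ d = -1) ∧ isU2 k) ∧
      d + ∑ α, (k α).1 = 0 ∧ d * a + ∑ α, (k α).1 * (k α).2 = 0 := by
  simp [inM, isU2, Fin.forall_fin_succ, Fin.sum_univ_succ]

/-- The only `a` for which `((±1, a), k)` can have zero momentum. -/
def closingMode {n : ℕ} (k : Fin n → ℤ × ℤ) : ℤ := (∑ α, (k α).1) * ∑ α, (k α).1 * (k α).2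

theorem closingMode_conjIdx {n : ℕ} (k : Fin n → ℤ × ℤ) :
    closingMode (conjIdx k) = closingMode k := by
  simp [closingMode, conjIdx]

theorem eq_closingMode {n : ℕ} {d a : ℤ} {k : Fin n → ℤ × ℤ}
    (h : inM (Fin.cons (d, a) k : Fin (n + 1) → ℤ × ℤ)) : a = closingMode k := by
  obtain ⟨⟨rfl | rfl, -⟩, hs, ht⟩ := (inM_cons_iff d a k).1 h
  · rw [closingMode, eq_neg_of_add_eq_zero_right hs, eq_neg_of_add_eq_zero_right ht]
    ring
  · rw [closingMode, eq_neg_of_add_eq_zero_right hs, eq_neg_of_add_eq_zero_right ht]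
    ring

theorem not_inM_cons_neg {n : ℕ} {d a : ℤ} {k : Fin n → ℤ × ℤ}
    (h : inM (Fin.cons (d, a) k : Fin (n + 1) → ℤ × ℤ)) :
    ¬ inM (Fin.cons (-d, a) k : Fin (n + 1) → ℤ × ℤ) := by
  rw [inM_cons_iff] at h ⊢
  omega

theorem inM_append {n n' : ℕ} {d a : ℤ} {k : Fin n → ℤ × ℤ} {l : Fin n' → ℤ × ℤ}
    (hk : inM (Fin.cons (d, a) k : Fin (n + 1) → ℤ × ℤ))
    (hl : inM (Fin.cons (-d, a) l : Fin (n' + 1) → ℤ × ℤ)) : inM (Fin.append k l) := by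
  obtain ⟨⟨-, hk₁⟩, hk₂, hk₃⟩ := (inM_cons_iff _ _ _).1 hk
  obtain ⟨⟨-, hl₁⟩, hl₂, hl₃⟩ := (inM_cons_iff _ _ _).1 hl
  refine ⟨fun α => ?_, ?_, ?_⟩
  · induction α using Fin.addCases with
    | left i => simpa using hk₁ i
    | right i => simpa using hl₁ i
  · simp only [Fin.sum_univ_add, Fin.append_left, Fin.append_right]
    linarith
  · simp only [Fin.sum_univ_add, Fin.append_left, Fin.append_right]
    linarith

theorem summable_norm_cons_mul_zProd {n : ℕ} {P : (Fin (n + 1) → ℤ × ℤ) → ℂ} (hP : inH P)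
    {z : ℤ → ℂ} (hz : Summable fun a => ‖z a‖) (p : ℤ × ℤ) :
    Summable fun k : Fin n → ℤ × ℤ => ‖P (Fin.cons p k) * zProd z k‖ := by
  refine Summable.of_nonneg_of_le (fun _ => norm_nonneg _) (fun k => ?_)
    ((summable_prod_idxAbs hz n).mul_left (supNorm P))
  by_cases h : P (Fin.cons p k) = 0
  · simpa [h] using mul_nonneg (supNorm_nonneg P) (prod_idxAbs_nonneg z k)
  · have hk := ((inM_cons_iff p.1 p.2 k).1 (hP.2.2.2 _ h)).1.2
    rw [norm_mul, norm_zProd_of_isU2 z hk]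
    exact mul_le_mul_of_nonneg_right (norm_le_supNorm hP _) (prod_idxAbs_nonneg z k)

theorem pderiv_eq_tsum_cons {n : ℕ} {P : (Fin (n + 1) → ℤ × ℤ) → ℂ} (hP : inH P)
    {z : ℤ → ℂ} (hz : Summable fun a => ‖z a‖) (p : ℤ × ℤ) :
    pderiv P z p = (n + 1 : ℂ) * ∑' k : Fin n → ℤ × ℤ, P (Fin.cons p k) * zProd z k := by
  have hs := (summable_norm_cons_mul_zProd hP hz p).of_norm.hasSum
  have hα (α : Fin (n + 1)) : HasSum (fun j : Fin (n + 1) → ℤ × ℤ =>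
      P j * if j α = p then ∏ β ∈ Finset.univ.erase α, idxVal z (j β) else 0)
      (∑' k : Fin n → ℤ × ℤ, P (Fin.cons p k) * zProd z k) := by
    rw [← (Fin.insertNth_right_injective (α := fun _ => ℤ × ℤ) (p := α) p).hasSum_iff]
    · refine hs.congr_fun fun k => ?_
      have hprod : ∏ β ∈ Finset.univ.erase α,
          idxVal z (α.insertNth (α := fun _ => ℤ × ℤ) p k β) = zProd z k := by
        rw [Fin.univ_succAbove n α, Finset.erase_cons, Finset.prod_map]
        simp [zProd]
      have hsymm : P (α.insertNth p k) = P (Fin.cons p k) := by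
        rw [← Fin.cons_comp_cycleRange, hP.2.1]
      simp [hprod, hsymm]
    · intro j hj
      have : j α ≠ p := fun h => hj ⟨α.removeNth j, by rw [← h, Fin.insertNth_self_removeNth]⟩
      simp [this]
  have := (hasSum_sum fun α (_ : α ∈ Finset.univ) => hα α).tsum_eq
  simp only [← Finset.mul_sum] at this
  rw [pderiv, this]
  simp

/-- The contribution of the mode `a` to the coefficient of `z_k z_l` in the bracket. -/
def modeCoeff {n n' : ℕ} (P : (Fin (n + 1) → ℤ × ℤ) → ℂ) (P' : (Fin (n' + 1) → ℤ × ℤ) → ℂ)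
    (a : ℤ) (k : Fin n → ℤ × ℤ) (l : Fin n' → ℤ × ℤ) : ℂ :=
  P (Fin.cons (1, a) k) * P' (Fin.cons (-1, a) l) - P (Fin.cons (-1, a) k) * P' (Fin.cons (1, a) l)

section Bracket

variable {n n' : ℕ} {P : (Fin (n + 1) → ℤ × ℤ) → ℂ} {P' : (Fin (n' + 1) → ℤ × ℤ) → ℂ}

theorem exists_inM_of_modeCoeff_ne_zero (hP : inH P) (hP' : inH P') {a : ℤ}
    {k : Fin n → ℤ × ℤ} {l : Fin n' → ℤ × ℤ} (h : modeCoeff P P' a k l ≠ 0) :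
    ∃ d : ℤ, inM (Fin.cons (d, a) k : Fin (n + 1) → ℤ × ℤ) ∧
      inM (Fin.cons (-d, a) l : Fin (n' + 1) → ℤ × ℤ) := by
  by_cases h₁ : P (Fin.cons (1, a) k) * P' (Fin.cons (-1, a) l) = 0
  · rw [modeCoeff, h₁, zero_sub, neg_ne_zero] at h
    exact ⟨-1, hP.2.2.2 _ (left_ne_zero_of_mul h), hP'.2.2.2 _ (right_ne_zero_of_mul h)⟩
  · exact ⟨1, hP.2.2.2 _ (left_ne_zero_of_mul h₁), hP'.2.2.2 _ (right_ne_zero_of_mul h₁)⟩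

theorem modeCoeff_eq_zero (hP : inH P) (hP' : inH P') {a : ℤ}
    {k : Fin n → ℤ × ℤ} {l : Fin n' → ℤ × ℤ} (ha : a ≠ closingMode k) :
    modeCoeff P P' a k l = 0 := by
  by_contra h
  obtain ⟨d, hk, -⟩ := exists_inM_of_modeCoeff_ne_zero hP hP' h
  exact ha (eq_closingMode hk)

theorem norm_modeCoeff_le (hP : inH P) (hP' : inH P') (a : ℤ)
    (k : Fin n → ℤ × ℤ) (l : Fin n' → ℤ × ℤ) :
    ‖modeCoeff P P' a k l‖ ≤ supNorm P * supNorm P' := by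
  have hmul (p q : ℤ × ℤ) :
      ‖P (Fin.cons p k) * P' (Fin.cons q l)‖ ≤ supNorm P * supNorm P' := by
    rw [norm_mul]
    exact mul_le_mul (norm_le_supNorm hP _) (norm_le_supNorm hP' _) (norm_nonneg _)
      (supNorm_nonneg P)
  by_cases h : P (Fin.cons (1, a) k) = 0
  · rw [modeCoeff, h, zero_mul, zero_sub, norm_neg]
    exact hmul _ _
  · have h' : P (Fin.cons (-1, a) k) = 0 :=
      of_not_not fun h' => not_inM_cons_neg (hP.2.2.2 _ h) (hP.2.2.2 _ h')
    rw [modeCoeff, h', zero_mul, sub_zero]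
    exact hmul _ _

theorem conj_modeCoeff (hP : inH P) (hP' : inH P') (a : ℤ)
    (k : Fin n → ℤ × ℤ) (l : Fin n' → ℤ × ℤ) :
    (starRingEnd ℂ) (modeCoeff P P' a k l) = -modeCoeff P P' a (conjIdx k) (conjIdx l) := by
  have h (d : ℤ) : (starRingEnd ℂ) (P (Fin.cons (d, a) k)) = P (Fin.cons (-d, a) (conjIdx k)) := by
    rw [← conjIdx_cons]
    exact hP.1 _
  have h' (d : ℤ) :
      (starRingEnd ℂ) (P' (Fin.cons (d, a) l)) = P' (Fin.cons (-d, a) (conjIdx l)) := by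
    rw [← conjIdx_cons]
    exact hP'.1 _
  simp only [modeCoeff, map_sub, map_mul, h, h', neg_neg]
  ring

theorem norm_modeCoeff_mul_le (hP : inH P) (hP' : inH P') (z : ℤ → ℂ) (a : ℤ)
    (k : Fin n → ℤ × ℤ) (l : Fin n' → ℤ × ℤ) :
    ‖modeCoeff P P' a k l * (zProd z k * zProd z l)‖ ≤
      if a = closingMode k then supNorm P * supNorm P' *
        ((∏ α, idxAbs z (k α)) * ∏ α, idxAbs z (l α)) else 0 := by
  split_ifs with ha
  · by_cases h : modeCoeff P P' a k l = 0
    · rw [h, zero_mul, norm_zero]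
      exact mul_nonneg (mul_nonneg (supNorm_nonneg P) (supNorm_nonneg P'))
        (mul_nonneg (prod_idxAbs_nonneg z k) (prod_idxAbs_nonneg z l))
    · obtain ⟨d, hk, hl⟩ := exists_inM_of_modeCoeff_ne_zero hP hP' h
      rw [norm_mul, norm_mul, norm_zProd_of_isU2 z ((inM_cons_iff _ _ _).1 hk).1.2,
        norm_zProd_of_isU2 z ((inM_cons_iff _ _ _).1 hl).1.2]
      exact mul_le_mul_of_nonneg_right (norm_modeCoeff_le hP hP' a k l)
        (mul_nonneg (prod_idxAbs_nonneg z k) (prod_idxAbs_nonneg z l))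
  · rw [modeCoeff_eq_zero hP hP' ha, zero_mul, norm_zero]

theorem summable_modeCoeff_mul (hP : inH P) (hP' : inH P') {z : ℤ → ℂ}
    (hz : Summable fun a => ‖z a‖) :
    Summable fun x : ((Fin n → ℤ × ℤ) × (Fin n' → ℤ × ℤ)) × ℤ =>
      modeCoeff P P' x.2 x.1.1 x.1.2 * (zProd z x.1.1 * zProd z x.1.2) := by
  refine Summable.of_norm_bounded ?_ fun x =>
    norm_modeCoeff_mul_le hP hP' z x.2 x.1.1 x.1.2
  have hinj : Function.Injective fun y : (Fin n → ℤ × ℤ) × (Fin n' → ℤ × ℤ) =>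
      (y, closingMode y.1) := fun _ _ h => (Prod.ext_iff.1 h).1
  refine (hinj.summable_iff fun x hx => if_neg fun h => hx ⟨x.1, ?_⟩).1 ?_
  · exact Prod.ext rfl h.symm
  · refine (((summable_prod_idxAbs hz n).mul_of_nonneg (summable_prod_idxAbs hz n')
      (prod_idxAbs_nonneg z) (prod_idxAbs_nonneg z)).mul_left
      (supNorm P * supNorm P')).congr fun y => ?_
    simp

/-- The unsymmetrized coefficients of the bracket. -/
def bracketCoeff (P : (Fin (n + 1) → ℤ × ℤ) → ℂ) (P' : (Fin (n' + 1) → ℤ × ℤ) → ℂ)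
    (j : Fin (n + n') → ℤ × ℤ) : ℂ :=
  Complex.I * ((n + 1 : ℂ) * (n' + 1 : ℂ)) *
    modeCoeff P P' (closingMode fun i => j (Fin.castAdd n' i)) (fun i => j (Fin.castAdd n' i))
      (fun i => j (Fin.natAdd n i))

theorem bracketCoeff_append (k : Fin n → ℤ × ℤ) (l : Fin n' → ℤ × ℤ) :
    bracketCoeff P P' (Fin.append k l) =
      Complex.I * ((n + 1 : ℂ) * (n' + 1 : ℂ)) * modeCoeff P P' (closingMode k) k l := by
  simp [bracketCoeff]

theorem norm_bracketCoeff_le (hP : inH P) (hP' : inH P') (j : Fin (n + n') → ℤ × ℤ) :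
    ‖bracketCoeff P P' j‖ ≤ (n + 1) * (n' + 1) * (supNorm P * supNorm P') := by
  have h (N : ℕ) : ‖(N + 1 : ℂ)‖ = N + 1 := by
    exact_mod_cast Complex.norm_natCast (N + 1)
  rw [bracketCoeff, norm_mul, norm_mul, norm_mul, h, h, Complex.norm_I, one_mul]
  exact mul_le_mul_of_nonneg_left (norm_modeCoeff_le hP hP' _ _ _) (by positivity)

theorem conj_bracketCoeff (hP : inH P) (hP' : inH P') (j : Fin (n + n') → ℤ × ℤ) :
    (starRingEnd ℂ) (bracketCoeff P P' j) = bracketCoeff P P' (conjIdx j) := by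
  have h := conj_modeCoeff hP hP' (closingMode fun i => j (Fin.castAdd n' i))
    (fun i => j (Fin.castAdd n' i)) (fun i => j (Fin.natAdd n i))
  have hm := closingMode_conjIdx fun i => j (Fin.castAdd n' i)
  rw [← hm] at h
  have hc : (starRingEnd ℂ) (Complex.I * ((n + 1 : ℂ) * (n' + 1 : ℂ))) =
      -(Complex.I * ((n + 1 : ℂ) * (n' + 1 : ℂ))) := by
    simp
  rw [bracketCoeff, ← hm, map_mul, h, hc, neg_mul_neg]
  rfl

theorem inM_of_bracketCoeff_ne_zero (hP : inH P) (hP' : inH P') {j : Fin (n + n') → ℤ × ℤ}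
    (h : bracketCoeff P P' j ≠ 0) : inM j := by
  obtain ⟨d, hk, hl⟩ := exists_inM_of_modeCoeff_ne_zero hP hP' (right_ne_zero_of_mul h)
  have hj : Fin.append (fun i => j (Fin.castAdd n' i)) (fun i => j (Fin.natAdd n i)) = j :=
    (Fin.appendEquiv n n').apply_symm_apply j
  exact hj ▸ inM_append hk hl

theorem hasSum_bracketCoeff (hP : inH P) (hP' : inH P') {z : ℤ → ℂ}
    (hz : Summable fun a => ‖z a‖) :
    HasSum (fun j => bracketCoeff P P' j * zProd z j) (pbracket P P' z) := by
  have hsum := summable_modeCoeff_mul hP hP' hz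
  have hmode (a : ℤ) : pderiv P z (1, a) * pderiv P' z (-1, a) -
      pderiv P z (-1, a) * pderiv P' z (1, a) = ((n + 1 : ℂ) * (n' + 1 : ℂ)) *
        ∑' y : (Fin n → ℤ × ℤ) × (Fin n' → ℤ × ℤ),
          modeCoeff P P' a y.1 y.2 * (zProd z y.1 * zProd z y.2) := by
    have hs := summable_norm_cons_mul_zProd hP hz
    have hs' := summable_norm_cons_mul_zProd hP' hz
    simp only [pderiv_eq_tsum_cons hP hz, pderiv_eq_tsum_cons hP' hz]
    rw [mul_mul_mul_comm, mul_mul_mul_comm (n + 1 : ℂ) (∑' k, P (Fin.cons (-1, a) k) * _),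
      ← mul_sub,
      tsum_mul_tsum_of_summable_norm (hs _) (hs' _), tsum_mul_tsum_of_summable_norm (hs _) (hs' _),
      ← (summable_mul_of_summable_norm (hs _) (hs' _)).tsum_sub
        (summable_mul_of_summable_norm (hs _) (hs' _))]
    congr 1
    refine tsum_congr fun y => ?_
    rw [modeCoeff]
    ring
  have hfiber (y : (Fin n → ℤ × ℤ) × (Fin n' → ℤ × ℤ)) :
      HasSum (fun a => modeCoeff P P' a y.1 y.2 * (zProd z y.1 * zProd z y.2))
        (modeCoeff P P' (closingMode y.1) y.1 y.2 * (zProd z y.1 * zProd z y.2)) :=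
    hasSum_single _ fun a ha => by rw [modeCoeff_eq_zero hP hP' ha, zero_mul]
  have hbracket : pbracket P P' z = Complex.I * ((n + 1 : ℂ) * (n' + 1 : ℂ)) *
      ∑' x : ((Fin n → ℤ × ℤ) × (Fin n' → ℤ × ℤ)) × ℤ,
        modeCoeff P P' x.2 x.1.1 x.1.2 * (zProd z x.1.1 * zProd z x.1.2) := by
    simp only [pbracket, hmode]
    rw [tsum_mul_left, hsum.tsum_prod, ← mul_assoc]
    congr 1
    exact Summable.tsum_comm (f := fun (y : (Fin n → ℤ × ℤ) × (Fin n' → ℤ × ℤ)) (a : ℤ) =>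
      modeCoeff P P' a y.1 y.2 * (zProd z y.1 * zProd z y.2)) hsum
  rw [hbracket, ← (Fin.appendEquiv n n').hasSum_iff]
  refine ((hsum.hasSum.prod_fiberwise hfiber).mul_left _).congr_fun fun y => ?_
  change bracketCoeff P P' (Fin.append y.1 y.2) * zProd z (Fin.append y.1 y.2) = _
  rw [bracketCoeff_append, zProd_append]
  ring

end Bracket

/-- The average of a family of coefficients over the permutations of the entries. -/
def symmetrize {n : ℕ} (F : (Fin n → ℤ × ℤ) → ℂ) (j : Fin n → ℤ × ℤ) : ℂ :=
  ((n.factorial : ℂ))⁻¹ * ∑ φ : Equiv.Perm (Fin n), F (j ∘ φ)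

section Symmetrize

variable {n : ℕ} {F : (Fin n → ℤ × ℤ) → ℂ}

theorem norm_symmetrize_le {C : ℝ} (hF : ∀ j, ‖F j‖ ≤ C) (j : Fin n → ℤ × ℤ) :
    ‖symmetrize F j‖ ≤ C := by
  have h : ‖∑ φ : Equiv.Perm (Fin n), F (j ∘ φ)‖ ≤ n.factorial * C := by
    refine (norm_sum_le_of_le _ fun (φ : Equiv.Perm (Fin n)) _ => hF (j ∘ φ)).trans_eq ?_
    simp [Fintype.card_perm]
  rw [symmetrize, norm_mul, norm_inv, Complex.norm_natCast]
  rwa [inv_mul_le_iff₀ (by exact_mod_cast n.factorial_pos)]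

theorem inH_symmetrize {C : ℝ} (hF : ∀ j, ‖F j‖ ≤ C)
    (hconj : ∀ j, (starRingEnd ℂ) (F j) = F (conjIdx j)) (hM : ∀ j, F j ≠ 0 → inM j) :
    inH (symmetrize F) := by
  refine ⟨fun j => ?_, fun j ψ => ?_, ⟨C, ?_⟩, fun j hj => ?_⟩
  · simp only [symmetrize, map_mul, map_inv₀, map_natCast, map_sum, hconj]
    rfl
  · rw [symmetrize, symmetrize]
    congr 1
    exact Equiv.sum_comp (Equiv.mulLeft ψ) fun φ : Equiv.Perm (Fin n) => F (j ∘ φ)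
  · rintro _ ⟨j, rfl⟩
    exact norm_symmetrize_le hF j
  · obtain ⟨φ, -, hφ⟩ := Finset.exists_ne_zero_of_sum_ne_zero (right_ne_zero_of_mul hj)
    exact (inM_comp_perm_iff j φ).1 (hM _ hφ)

theorem hasSum_symmetrize {z : ℤ → ℂ} {s : ℂ} (h : HasSum (fun j => F j * zProd z j) s) :
    HasSum (fun j => symmetrize F j * zProd z j) s := by
  have hφ (φ : Equiv.Perm (Fin n)) : HasSum (fun j => F (j ∘ φ) * zProd z j) s := by
    refine ((φ.symm.arrowCongr (Equiv.refl (ℤ × ℤ))).hasSum_iff.2 h).congr_fun fun j => ?_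
    change _ = F (j ∘ φ) * zProd z (j ∘ φ)
    rw [zProd_comp_perm]
  have hs := (hasSum_sum fun φ (_ : φ ∈ Finset.univ) => hφ φ).mul_left (n.factorial : ℂ)⁻¹
  have hn : (n.factorial : ℂ) ≠ 0 := by exact_mod_cast n.factorial_ne_zero
  have hval : (n.factorial : ℂ)⁻¹ * ∑ _φ : Equiv.Perm (Fin n), s = s := by
    simp [Fintype.card_perm, hn]
  rw [hval] at hs
  refine hs.congr_fun fun j => ?_
  rw [symmetrize, mul_assoc, Finset.sum_mul]

end Symmetrize

theorem exists_inH_hasSum_pbracket {A B n N N' : ℕ} (hA : A = N + 1) (hB : B = N' + 1)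
    (hn : n = N + N') (P : (Fin A → ℤ × ℤ) → ℂ) (hP : inH P)
    (P' : (Fin B → ℤ × ℤ) → ℂ) (hP' : inH P') :
    ∃ P'' : (Fin n → ℤ × ℤ) → ℂ, inH P'' ∧ supNorm P'' ≤ A * B * (supNorm P * supNorm P') ∧
      ∀ z : ℤ → ℂ, (Summable fun a => ‖z a‖) →
        HasSum (fun j => P'' j * zProd z j) (pbracket P P' z) := by
  subst hA hB hn
  have hbound := norm_bracketCoeff_le hP hP'
  refine ⟨symmetrize (bracketCoeff P P'), inH_symmetrize hbound (conj_bracketCoeff hP hP')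
    fun j => inM_of_bracketCoeff_ne_zero hP hP', ?_,
    fun z hz => hasSum_symmetrize (hasSum_bracketCoeff hP hP' hz)⟩
  push_cast
  exact ciSup_le (norm_symmetrize_le hbound)

/-- **Statement 7.** The Poisson bracket of `P ∈ H_m` and `P' ∈ H_{m'}` is a polynomial
`P'' ∈ H_{m+m'-1}` with `‖P''‖_{ℓ∞} ≤ 4 m m' ‖P‖_{ℓ∞} ‖P'‖_{ℓ∞}`. -/
theorem stmt7 (σ θ : ℝ) (hσ : 0 < σ) (hθ : θ ∈ Set.Ioo (0 : ℝ) 1)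
    (m m' : ℕ) (hm : 1 ≤ m) (hm' : 1 ≤ m')
    (P : (Fin (2 * m) → ℤ × ℤ) → ℂ) (hP : inH P)
    (P' : (Fin (2 * m') → ℤ × ℤ) → ℂ) (hP' : inH P') :
    ∃ P'' : (Fin (2 * (m + m' - 1)) → ℤ × ℤ) → ℂ, inH P'' ∧
      supNorm P'' ≤ 4 * m * m' * supNorm P * supNorm P' ∧
      ∀ z : ℤ → ℂ, inG σ θ z →
        pbracket P P' z = ∑' j : Fin (2 * (m + m' - 1)) → ℤ × ℤ, P'' j * zProd z j := by
  obtain ⟨P'', hH, hsup, hsum⟩ := exists_inH_hasSum_pbracket (A := 2 * m) (B := 2 * m')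
    (n := 2 * (m + m' - 1)) (N := 2 * m - 1) (N' := 2 * m' - 1) (by omega) (by omega) (by omega)
    P hP P' hP'
  refine ⟨P'', hH, hsup.trans_eq ?_, fun z hz => (hsum z (summable_norm_of_inG hσ hz)).tsum_eq.symm⟩
  push_cast
  ring
end
end
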